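/- arXiv:2510.00364 — 2 statements merged into one kernel-verified Lean document; each statement's English description precedes it below -/
import Mathlib

section
/- Let k ≥ 3 and let h_1, h_2, …, h_k be positive integers with h_1 = h_2 = h_3 ≥ h_4 ≥ … ≥ h_k. Then there exists a realization LS(h_1 h_2 h_3 h_4 … h_k), i.e. a latin square of order n = h_1+…+h_k with pairwise disjoint subsquares of orders h_1, …, h_k. -/
/-- A latin square of order `n`: an `n × n` array with symbols from a set of
size `n` (encoded as `Fin n`) such that every symbol occurs exactly once in
every row and every column. -/
def IsLatinSquare {n : ℕ} (L : Fin n → Fin n → Fin n) : Prop :=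
  (∀ i, Function.Bijective fun j => L i j) ∧ (∀ j, Function.Bijective fun i => L i j)

/-- `L` has pairwise disjoint subsquares of orders `h 0, …, h (k-1)`:
for each `i` there are sets `R i` of rows, `C i` of columns and `S i` of
symbols, each of size `h i`, pairwise disjoint (no shared rows, columns or
symbols), such that the subarray on rows `R i` and columns `C i` only uses
the symbols `S i` (given that `L` is a latin square, this subarray is then
itself a latin square of order `h i` on the symbol set `S i`). -/
def HasDisjointSubsquares {n k : ℕ} (L : Fin n → Fin n → Fin n) (h : Fin k → ℕ) : Prop :=
  ∃ R C S : Fin k → Finset (Fin n),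
    (∀ i, (R i).card = h i) ∧ (∀ i, (C i).card = h i) ∧ (∀ i, (S i).card = h i) ∧
    (∀ i j, i ≠ j → Disjoint (R i) (R j)) ∧
    (∀ i j, i ≠ j → Disjoint (C i) (C j)) ∧
    (∀ i j, i ≠ j → Disjoint (S i) (S j)) ∧
    (∀ i, ∀ x ∈ R i, ∀ y ∈ C i, L x y ∈ S i)

/-- An incomplete latin square `ILS(n; h_1 … h_k)`: a latin square of order `n`
with pairwise disjoint subsquares of orders `h_1, …, h_k`. -/
def HasILS (n : ℕ) {k : ℕ} (h : Fin k → ℕ) : Prop :=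
  ∃ L : Fin n → Fin n → Fin n, IsLatinSquare L ∧ HasDisjointSubsquares L h

/-- A realization of the partition `(h_1 … h_k)` of `n = h_1 + … + h_k`:
a latin square of order `n` with pairwise disjoint subsquares of orders
`h_1, …, h_k`. -/
def HasRealization {k : ℕ} (h : Fin k → ℕ) : Prop :=
  HasILS (∑ i, h i) h

section Outlines

open Finset

theorem card_filter_mem_eq_mul {E X : Type*} [DecidableEq X] {S : Finset E} {q : E → X} {n : ℕ}
    (hq : ∀ a, #{e ∈ S | q e = a} = n) (s : Finset X) : #{e ∈ S | q e ∈ s} = n * #s := by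
  rw [card_eq_sum_card_fiberwise (f := q) (t := s) (by intro e; simp), mul_comm,
    ← smul_eq_mul, ← sum_const]
  refine sum_congr rfl fun a ha => ?_
  rw [← hq a, filter_filter]
  congr 1
  ext e
  simp only [mem_filter]
  constructor
  · tauto
  · rintro ⟨h1, h2⟩
    exact ⟨h1, h2 ▸ ha, h2⟩

/-- A bipartite multigraph with edge set `S`, all of whose degrees are `n`, is the disjoint union of
`n` perfect matchings. -/
theorem exists_edge_colouring {E A B : Type*} [Fintype A] [Fintype B] [DecidableEq E]
    [DecidableEq A] [DecidableEq B] (f : E → A) (g : E → B) (n : ℕ) (S : Finset E)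
    (hf : ∀ a, #{e ∈ S | f e = a} = n) (hg : ∀ b, #{e ∈ S | g e = b} = n) :
    ∃ c : E → ℕ, (∀ e ∈ S, c e < n) ∧ (∀ k < n, ∀ a, #{e ∈ S | f e = a ∧ c e = k} = 1) ∧
      ∀ k < n, ∀ b, #{e ∈ S | g e = b ∧ c e = k} = 1 := by
  induction n generalizing S with
  | zero =>
    refine ⟨fun _ => 0, fun e he => ?_, by simp, by simp⟩
    have := hf (f e)
    rw [card_eq_zero, filter_eq_empty_iff] at this
    exact absurd rfl (this he)
  | succ n ih =>
    obtain ⟨φ, hφ, hmem⟩ := (all_card_le_biUnion_card_iff_exists_injective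
      (fun a => ({e ∈ S | f e = a}).image g)).1 (by
        intro s
        have : #{e ∈ S | f e ∈ s} ≤
            #{e ∈ S | g e ∈ s.biUnion fun a => ({e ∈ S | f e = a}).image g} := by
          refine card_le_card fun e he => ?_
          simp only [mem_filter, mem_biUnion, mem_image] at he ⊢
          exact ⟨he.1, f e, he.2, e, ⟨he.1, rfl⟩, rfl⟩
        rw [card_filter_mem_eq_mul hf, card_filter_mem_eq_mul hg] at this
        exact Nat.le_of_mul_le_mul_left this n.succ_pos)
    have hcard : Fintype.card A = Fintype.card B := by
      have h1 := card_filter_mem_eq_mul hf univ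
      have h2 := card_filter_mem_eq_mul hg univ
      simp only [mem_univ, filter_true, card_univ] at h1 h2
      exact Nat.eq_of_mul_eq_mul_left n.succ_pos (h1.symm.trans h2)
    have hbij : Function.Bijective φ := (Fintype.bijective_iff_injective_and_card φ).2 ⟨hφ, hcard⟩
    simp only [mem_image, mem_filter] at hmem
    choose ed hed hedg using hmem
    have hfib (a : A) : {e ∈ univ.image ed | f e = a} = {ed a} := by
      ext e
      simp only [mem_filter, mem_image, mem_univ, true_and, mem_singleton]
      constructor
      · rintro ⟨⟨a', rfl⟩, h⟩
        rw [(hed a').2] at h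
        rw [h]
      · rintro rfl
        exact ⟨⟨a, rfl⟩, (hed a).2⟩
    have hgib (a : A) : {e ∈ univ.image ed | g e = φ a} = {ed a} := by
      ext e
      simp only [mem_filter, mem_image, mem_univ, true_and, mem_singleton]
      constructor
      · rintro ⟨⟨a', rfl⟩, h⟩
        rw [hedg a'] at h
        rw [hφ h]
      · rintro rfl
        exact ⟨⟨a, rfl⟩, hedg a⟩
    have hsub : univ.image ed ⊆ S := by
      intro e
      simp only [mem_image, mem_univ, true_and]
      rintro ⟨a, rfl⟩
      exact (hed a).1
    have split (P : E → Prop) [DecidablePred P] :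
        #{e ∈ S | P e} = #{e ∈ S \ univ.image ed | P e} + #{e ∈ univ.image ed | P e} := by
      rw [← card_union_of_disjoint (disjoint_filter_filter sdiff_disjoint), ← filter_union,
        sdiff_union_of_subset hsub]
    obtain ⟨c, hc, hcf, hcg⟩ := ih (S \ univ.image ed)
      (fun a => by
        have := split (fun e => f e = a)
        rw [hf, hfib, card_singleton] at this
        omega)
      (fun b => by
        obtain ⟨a, rfl⟩ := hbij.2 b
        have := split (fun e => g e = φ a)
        rw [hg, hgib, card_singleton] at this
        omega)
    have extend (P : E → Prop) [DecidablePred P] (hM : #{e ∈ univ.image ed | P e} = 1)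
        (hP : ∀ k < n, #{e ∈ S \ univ.image ed | P e ∧ c e = k} = 1) (k : ℕ) (hk : k < n + 1) :
        #{e ∈ S | P e ∧ (if e ∈ univ.image ed then n else c e) = k} = 1 := by
      rw [split, filter_congr (q := fun e => P e ∧ c e = k) (s := S \ univ.image ed) (by
        intro e he
        rw [if_neg (mem_sdiff.1 he).2]), filter_congr (q := fun e => P e ∧ n = k)
        (s := univ.image ed) (by
          intro e he
          rw [if_pos he])]
      by_cases hkn : n = k
      · subst hkn
        rw [filter_congr (q := fun e => False) (s := S \ univ.image ed) (by
          intro e he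
          have := hc e he
          simp only [iff_false, not_and]
          omega)]
        simpa using hM
      · simp only [hkn, and_false, filter_false, card_empty, add_zero]
        exact hP k (by omega)
    refine ⟨fun e => if e ∈ univ.image ed then n else c e, fun e he => ?_, fun k hk a => ?_,
      fun k hk b => ?_⟩
    · by_cases h : e ∈ univ.image ed
      · simp only [if_pos h]; omega
      · simp only [if_neg h]
        have := hc e (mem_sdiff.2 ⟨he, h⟩)
        omega
    · exact extend _ (by rw [hfib, card_singleton]) (fun k hk => hcf k hk a) k hk
    · obtain ⟨a, rfl⟩ := hbij.2 b
      exact extend _ (by rw [hgib, card_singleton]) (fun k hk => hcg k hk _) k hk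

/-- A map whose fibres have sizes `n * r i` lifts to a map into `Σ i, Fin (r i)` whose fibres all
have size `n`. -/
theorem exists_equitable_lift {E I : Type*} [Fintype E] [DecidableEq I] (n : ℕ) (r : I → ℕ)
    (f : E → I) (hf : ∀ i, #{e | f e = i} = n * r i) :
    ∃ f' : E → Σ i, Fin (r i), (∀ e, (f' e).1 = f e) ∧ ∀ p, #{e | f' e = p} = n := by
  have key (i : I) : Nonempty ({e // f e = i} ≃ Fin n × Fin (r i)) := by
    rw [← Fintype.card_eq, Fintype.card_subtype, hf, Fintype.card_prod, Fintype.card_fin,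
      Fintype.card_fin]
  let φ (i : I) := (key i).some
  refine ⟨fun e => ⟨f e, (φ (f e) ⟨e, rfl⟩).2⟩, fun e => rfl, ?_⟩
  rintro ⟨i, p⟩
  have hval (e : E) (he : f e = i) :
      ((⟨f e, (φ (f e) ⟨e, rfl⟩).2⟩ : Σ i, Fin (r i)) = ⟨i, p⟩) ↔ (φ i ⟨e, he⟩).2 = p := by
    subst he
    simp
  refine Eq.trans ?_ (card_fin n)
  refine (card_bij (fun t _ => ((φ i).symm (t, p) : E)) ?_ ?_ ?_).symm
  · intro t _
    have h1 := ((φ i).symm (t, p)).2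
    simp only [mem_filter, mem_univ, true_and]
    rw [hval _ h1]
    simp
  · intro t _ t' _ h
    have := (φ i).symm.injective (Subtype.ext h)
    exact (Prod.ext_iff.1 this).1
  · intro e he
    simp only [mem_filter, mem_univ, true_and] at he
    have h1 : f e = i := (Sigma.mk.inj_iff.1 he).1
    rw [hval e h1] at he
    refine ⟨(φ i ⟨e, h1⟩).1, mem_univ _, ?_⟩
    rw [← he]
    simp

theorem exists_map_card_fiber_eq {K : Type*} [Fintype K] [DecidableEq K] [Nonempty K] (g : K → ℕ) :
    ∃ κ : ℕ → K, ∀ k, #{c ∈ range (∑ k, g k) | κ c = k} = g k := by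
  have e : Fin (∑ k, g k) ≃ Σ k, Fin (g k) := Fintype.equivOfCardEq (by simp)
  refine ⟨fun c => if h : c < ∑ k, g k then (e ⟨c, h⟩).1 else Classical.arbitrary K, fun k => ?_⟩
  rw [← Fintype.card_fin (g k), ← card_univ]
  refine (card_bij (fun t _ => (e.symm ⟨k, t⟩ : ℕ)) ?_ ?_ ?_).symm
  · intro t _
    simp
  · intro t _ t' _ h
    have := e.symm.injective (Fin.ext h)
    simpa using this
  · intro c hc
    obtain ⟨h1, h2⟩ := mem_filter.1 hc
    rw [mem_range] at h1
    simp only [dif_pos h1] at h2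
    subst h2
    exact ⟨(e ⟨c, h1⟩).2, mem_univ _, by simp⟩

theorem card_filter_fst_and_eq_mul {E X K : Type*} [Fintype E] [DecidableEq X] [DecidableEq K]
    {w : X → ℕ} (q : E → Σ x, Fin (w x)) (col : E → ℕ) (κ : ℕ → K) (N : ℕ)
    (hlt : ∀ e, col e < N) (hq : ∀ k < N, ∀ a, #{e | q e = a ∧ col e = k} = 1) (k : K) (x : X) :
    #{e | (q e).1 = x ∧ κ (col e) = k} = #{c ∈ range N | κ c = k} * w x := by
  rw [card_eq_sum_card_fiberwise (f := fun e => (col e, q e))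
    (t := {c ∈ range N | κ c = k} ×ˢ univ.map (Function.Embedding.sigmaMk x)), sum_eq_card_nsmul
    (b := 1)]
  · simp [card_product]
  · rintro ⟨c, y⟩ hcy
    simp only [mem_product, mem_filter, mem_range, mem_map, mem_univ, true_and,
      Function.Embedding.sigmaMk_apply] at hcy
    obtain ⟨⟨hc, hk⟩, p, rfl⟩ := hcy
    rw [← hq c hc ⟨x, p⟩, filter_filter]
    congr 1
    ext e
    simp only [mem_filter, mem_univ, true_and, Prod.mk.injEq]
    constructor
    · tauto
    · rintro ⟨h1, rfl⟩
      simp [h1, hk]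
  · intro e he
    simp only [coe_filter, mem_univ, true_and, Set.mem_ofPred_eq] at he
    obtain ⟨rfl, rfl⟩ := he
    simp [hlt]

/-- A matrix of natural numbers whose row sums and column sums are multiples of `∑ k, g k` splits
into matrices whose row and column sums are the corresponding multiples of the `g k`. -/
theorem exists_matrix_splitting {I J K : Type*} [Fintype I] [Fintype J] [Fintype K]
    (W : I → J → ℕ) (g : K → ℕ) (r : I → ℕ) (c : J → ℕ)
    (hr : ∀ i, ∑ j, W i j = (∑ k, g k) * r i) (hc : ∀ j, ∑ i, W i j = (∑ k, g k) * c j) :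
    ∃ V : K → I → J → ℕ, (∀ i j, ∑ k, V k i j = W i j) ∧ (∀ k i, ∑ j, V k i j = g k * r i) ∧
      ∀ k j, ∑ i, V k i j = g k * c j := by
  classical
  rcases isEmpty_or_nonempty K with hK | hK
  · simp only [univ_eq_empty, sum_empty, zero_mul, sum_eq_zero_iff, mem_univ, true_imp_iff] at hr
    exact ⟨fun k => hK.elim k, fun i j => by simp [hr i j], fun k => hK.elim k,
      fun k => hK.elim k⟩
  let E := Σ p : I × J, Fin (W p.1 p.2)
  have cardE (P : I × J → Prop) [DecidablePred P] :
      #{e : E | P e.1} = ∑ i, ∑ j, if P (i, j) then W i j else 0 := by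
    rw [← Fintype.sum_prod_type' (f := fun i j => if P (i, j) then W i j else 0), card_filter,
      ← univ_sigma_univ, sum_sigma]
    refine sum_congr rfl fun p _ => ?_
    by_cases hp : P p <;> simp [hp]
  obtain ⟨f, hf, hfc⟩ := exists_equitable_lift (∑ k, g k) r (fun e : E => e.1.1) fun i => by
    rw [cardE fun p => p.1 = i, ← hr, sum_eq_single i]
    · simp
    · intro i' _ h
      simp [h]
    · simp
  obtain ⟨f', hf', hfc'⟩ := exists_equitable_lift (∑ k, g k) c (fun e : E => e.1.2) fun j => by
    rw [cardE fun p => p.2 = j, ← hc]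
    refine sum_congr rfl fun i _ => ?_
    simp
  obtain ⟨κ, hκ⟩ := exists_map_card_fiber_eq g
  obtain ⟨col, hlt, hcol, hcol'⟩ := exists_edge_colouring f f' (∑ k, g k) univ hfc hfc'
  refine ⟨fun k i j => #{e : E | e.1 = (i, j) ∧ κ (col e) = k}, fun i j => ?_, fun k i => ?_,
    fun k j => ?_⟩
  · have h1 : #{e : E | e.1 = (i, j)} = W i j := by
      rw [cardE fun p => p = (i, j), sum_eq_single i, sum_eq_single j] <;> simp +contextual
    rw [← h1, card_eq_sum_card_fiberwise (f := fun e => κ (col e)) (t := univ) (by simp)]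
    simp_rw [filter_filter]
  · rw [← hκ k, ← card_filter_fst_and_eq_mul f col κ _ (fun e => hlt e (mem_univ e)) hcol,
      card_eq_sum_card_fiberwise (f := fun e => e.1.2) (t := univ) (by simp)]
    refine sum_congr rfl fun j _ => ?_
    simp_rw [filter_filter, hf]
    congr 1
    ext ⟨⟨i', j'⟩, e⟩
    simp only [mem_filter, mem_univ, true_and, Prod.mk.injEq]
    tauto
  · rw [← hκ k, ← card_filter_fst_and_eq_mul f' col κ _ (fun e => hlt e (mem_univ e)) hcol',
      card_eq_sum_card_fiberwise (f := fun e => e.1.1) (t := univ) (by simp)]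
    refine sum_congr rfl fun i _ => ?_
    simp_rw [filter_filter, hf']
    congr 1
    ext ⟨⟨i', j'⟩, e⟩
    simp only [mem_filter, mem_univ, true_and, Prod.mk.injEq]
    tauto

/-- `x i j l` counts the occurrences of symbols of class `l` in the block of rows of class `i` and
columns of class `j` of a would-be latin square with the given class sizes. -/
def IsOutline {A B C : Type*} [Fintype A] [Fintype B] [Fintype C] (wA : A → ℕ) (wB : B → ℕ)
    (wC : C → ℕ) (x : A → B → C → ℕ) : Prop :=
  (∀ i j, ∑ l, x i j l = wA i * wB j) ∧ (∀ i l, ∑ j, x i j l = wA i * wC l) ∧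
    ∀ j l, ∑ i, x i j l = wB j * wC l

/-- An outline array for a latin square with disjoint subsquares of orders `h i`. -/
def HasOutline {ι : Type*} [Fintype ι] (h : ι → ℕ) : Prop :=
  ∃ x : ι → ι → ι → ℕ, IsOutline h h h x ∧ ∀ i, x i i i = h i * h i

theorem IsOutline.rotate {A B C : Type*} [Fintype A] [Fintype B] [Fintype C] {wA : A → ℕ}
    {wB : B → ℕ} {wC : C → ℕ} {x : A → B → C → ℕ} (hx : IsOutline wA wB wC x) :
    IsOutline wB wC wA fun j l i => x i j l :=
  ⟨hx.2.2, fun j i => (hx.1 i j).trans (mul_comm _ _), fun l i => (hx.2.1 i l).trans (mul_comm _ _)⟩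

/-- The last classes of an outline can be split into singletons. -/
theorem IsOutline.exists_split {A B C : Type*} [Fintype A] [Fintype B] [Fintype C] {wA : A → ℕ}
    {wB : B → ℕ} {wC : C → ℕ} {x : A → B → C → ℕ} (hx : IsOutline wA wB wC x) :
    ∃ y : A → B → (Σ l, Fin (wC l)) → ℕ, IsOutline wA wB (fun _ => 1) y ∧
      ∀ i j l, y i j l ≤ x i j l.1 := by
  choose V hV hVr hVc using fun l : C => exists_matrix_splitting (fun i j => x i j l)
    (fun _ : Fin (wC l) => 1) wA wB (fun i => by simp [hx.2.1, mul_comm])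
    (fun j => by simp [hx.2.2, mul_comm])
  refine ⟨fun i j l => V l.1 l.2 i j, ⟨fun i j => ?_, fun i l => ?_, fun j l => ?_⟩,
    fun i j l => ?_⟩
  · rw [← hx.1, Fintype.sum_sigma]
    exact sum_congr rfl fun l _ => hV l i j
  · rw [hVr, mul_comm]
  · rw [hVc, mul_comm]
  · rw [← hV]
    exact single_le_sum (f := fun k => V l.1 k i j) (fun _ _ => Nat.zero_le _) (mem_univ l.2)

theorem existsUnique_ne_zero_of_sum_eq_one {α : Type*} [Fintype α] {f : α → ℕ}
    (hf : ∑ a, f a = 1) : ∃! a, f a ≠ 0 := by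
  classical
  obtain ⟨a, ha⟩ : ∃ a, f a ≠ 0 := by
    by_contra! h
    simp [h] at hf
  refine ⟨a, ha, fun b hb => ?_⟩
  by_contra hab
  have := sum_le_sum_of_subset (f := f) (subset_univ {b, a})
  rw [sum_pair hab, hf] at this
  dsimp only at hb
  omega

theorem HasOutline.hasRealization {k : ℕ} {h : Fin k → ℕ} (hh : HasOutline h) :
    HasRealization h := by
  obtain ⟨x, hx, hdiag⟩ := hh
  obtain ⟨y₁, hy₁, hle₁⟩ := hx.exists_split
  obtain ⟨y₂, hy₂, hle₂⟩ := hy₁.rotate.exists_split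
  obtain ⟨y, hy, hle⟩ := hy₂.rotate.exists_split
  have hyx (i j l : Σ i, Fin (h i)) (hne : y l i j ≠ 0) : x i.1 j.1 l.1 ≠ 0 := by
    have := (hle l i j).trans ((hle₂ j.1 l i).trans (hle₁ i.1 j.1 l))
    omega
  have hoff (i l : Fin k) (hil : l ≠ i) : x i i l = 0 := by
    have := sum_le_sum_of_subset (f := x i i) (subset_univ {l, i})
    rw [sum_pair hil, hx.1, hdiag] at this
    omega
  let e : Fin (∑ i, h i) ≃ Σ i, Fin (h i) := Fintype.equivOfCardEq (by simp)
  have hL (i j : Σ i, Fin (h i)) := existsUnique_ne_zero_of_sum_eq_one (hy.2.2 i j)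
  choose L hLne hLuniq using hL
  have hbij {f : (Σ i, Fin (h i)) → Σ i, Fin (h i)} (hf : Function.Injective f) :
      Function.Bijective fun i => e.symm (f (e i)) :=
    e.symm.bijective.comp ((Finite.injective_iff_bijective.1 hf).comp e.bijective)
  refine ⟨fun i j => e.symm (L (e i) (e j)), ⟨fun i => ?_, fun j => ?_⟩, ?_⟩
  · refine hbij (f := L (e i)) fun j j' hjj => ?_
    refine (existsUnique_ne_zero_of_sum_eq_one (hy.1 (L (e i) j) (e i))).unique (hLne (e i) j) ?_
    rw [hjj]
    exact hLne _ _
  · refine hbij (f := fun i => L i (e j)) fun i i' hii => ?_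
    refine (existsUnique_ne_zero_of_sum_eq_one (hy.2.1 (L i (e j)) (e j))).unique (hLne i _) ?_
    simp only at hii
    rw [hii]
    exact hLne _ _
  · let R (i : Fin k) : Finset (Fin (∑ i, h i)) := {t | (e t).1 = i}
    have hcard (i : Fin k) : (R i).card = h i := by
      refine Eq.trans ?_ (card_fin (h i))
      refine (card_bij (fun t _ => e.symm ⟨i, t⟩) ?_ ?_ ?_).symm
      · simp [R]
      · intro t _ t' _ htt
        simpa using htt
      · intro c hc
        simp only [R, mem_filter, mem_univ, true_and] at hc
        subst hc
        exact ⟨(e c).2, mem_univ _, by simp⟩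
    have hdisj (i j : Fin k) (hij : i ≠ j) : Disjoint (R i) (R j) := by
      rw [disjoint_left]
      simp only [R, mem_filter, mem_univ, true_and]
      rintro t rfl
      exact hij
    refine ⟨R, R, R, hcard, hcard, hcard, hdisj, hdisj, hdisj, fun i t ht t' ht' => ?_⟩
    simp only [R, mem_filter, mem_univ, true_and, Equiv.apply_symm_apply] at ht ht' ⊢
    have := hyx _ _ _ (hLne (e t) (e t'))
    rw [ht, ht'] at this
    by_contra hne
    exact this (hoff _ _ hne)

/-- Simultaneous splitting of three square arrays, with slacks `r`, `c`, `s`, into three parts of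
equal margins. -/
theorem exists_three_splitting {J : Type*} [Fintype J] (a : ℕ) (h : J → ℕ) (U V X : J → J → ℕ)
    (r c s : J → ℕ) (hUr : ∀ j, ∑ i, U j i + r j = 3 * a * h j)
    (hVr : ∀ j, ∑ l, V j l + r j = 3 * a * h j) (hUc : ∀ i, ∑ j, U j i + c i = 3 * a * h i)
    (hXc : ∀ i, ∑ l, X i l + c i = 3 * a * h i) (hVs : ∀ l, ∑ j, V j l + s l = 3 * a * h l)
    (hXs : ∀ l, ∑ i, X i l + s l = 3 * a * h l) :
    ∃ (U' V' X' : Fin 3 → J → J → ℕ) (r' c' s' : Fin 3 → J → ℕ),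
      (∀ j i, ∑ q, U' q j i = U j i) ∧ (∀ j l, ∑ q, V' q j l = V j l) ∧
      (∀ i l, ∑ q, X' q i l = X i l) ∧ (∀ j, ∑ q, r' q j = r j) ∧
      (∀ q j, ∑ i, U' q j i + r' q j = a * h j) ∧ (∀ q j, ∑ l, V' q j l + r' q j = a * h j) ∧
      (∀ q i, ∑ j, U' q j i + c' q i = a * h i) ∧ (∀ q i, ∑ l, X' q i l + c' q i = a * h i) ∧
      (∀ q l, ∑ j, V' q j l + s' q l = a * h l) ∧ (∀ q l, ∑ i, X' q i l + s' q l = a * h l) := by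
  classical
  let slack (r : J → ℕ) (j i : J) : ℕ := if j = i then r j else 0
  let W (p q : Fin 3 × J) : ℕ :=
    match p.1, q.1 with
    | 0, 0 => slack r p.2 q.2
    | 0, 1 => U p.2 q.2
    | 0, 2 => 0
    | 1, 0 => 0
    | 1, 1 => slack c p.2 q.2
    | 1, 2 => X p.2 q.2
    | 2, 0 => V q.2 p.2
    | 2, 1 => 0
    | 2, 2 => slack s p.2 q.2
  obtain ⟨Y, hY, hYr, hYc⟩ := exists_matrix_splitting W (fun _ : Fin 3 => a) (fun p => h p.2)
    (fun p => h p.2)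
    (by
      rintro ⟨p, j⟩
      rw [Fintype.sum_prod_type, Fin.sum_univ_three]
      have h0 := hUr j
      have h1 := hXc j
      have h2 := hVs j
      fin_cases p <;> simp [W, slack] <;> linarith)
    (by
      rintro ⟨p, j⟩
      rw [Fintype.sum_prod_type, Fin.sum_univ_three]
      have h0 := hVr j
      have h1 := hUc j
      have h2 := hXs j
      fin_cases p <;> simp [W, slack] <;> linarith)
  have hzero {p q : Fin 3 × J} (hW : W p q = 0) (k : Fin 3) : Y k p q = 0 := by
    have := single_le_sum (f := fun k => Y k p q) (fun _ _ => Nat.zero_le _) (mem_univ k)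
    rw [hY, hW] at this
    simpa using this
  have hdiag (t : Fin 3) (j i : J) (hji : j ≠ i) (k : Fin 3) : Y k (t, j) (t, i) = 0 := by
    apply hzero
    fin_cases t <;> simp [W, slack, hji]
  have hdr (k t : Fin 3) (j : J) : ∑ i, Y k (t, j) (t, i) = Y k (t, j) (t, j) :=
    sum_eq_single j (fun i _ hi => hdiag t j i hi.symm k) (by simp)
  have hdc (k t : Fin 3) (j : J) : ∑ i, Y k (t, i) (t, j) = Y k (t, j) (t, j) :=
    sum_eq_single j (fun i _ hi => hdiag t i j hi k) (by simp)
  have h02 (k : Fin 3) (j i : J) : Y k (0, j) (2, i) = 0 := hzero rfl k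
  have h10 (k : Fin 3) (j i : J) : Y k (1, j) (0, i) = 0 := hzero rfl k
  have h21 (k : Fin 3) (j i : J) : Y k (2, j) (1, i) = 0 := hzero rfl k
  simp only [Fintype.sum_prod_type, Fin.sum_univ_three, Prod.forall] at hYr hYc
  refine ⟨fun q j i => Y q (0, j) (1, i), fun q j l => Y q (2, l) (0, j),
    fun q i l => Y q (1, i) (2, l), fun q j => Y q (0, j) (0, j), fun q j => Y q (1, j) (1, j),
    fun q j => Y q (2, j) (2, j), fun j i => hY _ _, fun j i => hY _ _, fun j i => hY _ _,
    fun j => ?_, fun q j => ?_, fun q j => ?_, fun q j => ?_, fun q j => ?_, fun q j => ?_,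
    fun q j => ?_⟩
  · rw [hY]
    simp [W, slack]
  · rw [← hYr q 0 j, hdr]
    simp [h02, add_comm]
  · rw [← hYc q 0 j, hdc]
    simp [h10, add_comm]
  · rw [← hYc q 1 j, hdc]
    simp [h21]
  · rw [← hYr q 1 j, hdr]
    simp [h10, add_comm]
  · rw [← hYr q 2 j, hdr]
    simp [h21]
  · rw [← hYc q 2 j, hdc]
    simp [h02]

/-- The array on three classes of size `a` together with the classes `J`, assembled from a partial
array `z` on `J` and from splittings of what `z` leaves uncovered. -/
def completionArray {J : Type*} [DecidableEq J] (a : ℕ) (h : J → ℕ) (z : J → J → J → ℕ)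
    (U V X : Fin 3 → J → J → ℕ) (r c s : Fin 3 → J → ℕ) (t : Fin 3 → ℕ) :
    Fin 3 ⊕ J → Fin 3 ⊕ J → Fin 3 ⊕ J → ℕ
  | .inl p, .inl q, .inl u =>
    if p = q ∧ q = u then a * a
    else if q = p + 1 ∧ u = p + 2 then a * a - t u
    else if q = p + 2 ∧ u = p + 1 then a * a
    else 0
  | .inl p, .inl q, .inr l => if q = p + 1 then s (p + 2) l else 0
  | .inl p, .inr i, .inl u => if u = p + 2 then c (p + 2) i else 0
  | .inr j, .inl p, .inl u => if u = p + 1 then r (p + 1) j else 0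
  | .inl p, .inr i, .inr l => X (p + 2) i l
  | .inr j, .inl p, .inr l => V (p + 1) j l
  | .inr j, .inr i, .inl q => U q j i
  | .inr j, .inr i, .inr l => z j i l + if j = i ∧ i = l then h j * h j else 0

/-- A partial array `z` on the classes `J` can be completed with three further classes of size `a`
if what it leaves uncovered is small, but not much smaller than what these classes can absorb. -/
theorem hasOutline_of_partial {J : Type*} [Fintype J] [DecidableEq J] (a : ℕ) (h : J → ℕ)
    (z : J → J → J → ℕ) (U V X : J → J → ℕ) (r c s : J → ℕ)
    (hU : ∀ j i, ∑ l, z j i l + U j i = if j = i then 0 else h j * h i)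
    (hV : ∀ j l, ∑ i, z j i l + V j l = if j = l then 0 else h j * h l)
    (hX : ∀ i l, ∑ j, z j i l + X i l = if i = l then 0 else h i * h l)
    (hr : ∀ j, ∑ i, U j i + r j = 3 * a * h j) (hc : ∀ i, ∑ j, U j i + c i = 3 * a * h i)
    (hs : ∀ l, ∑ j, V j l + s l = 3 * a * h l) (hle : ∑ j, r j ≤ a * a) :
    HasOutline (Sum.elim (fun _ : Fin 3 => a) h) := by
  have hsum (A : J → J → ℕ) (B : J → J → ℕ) (w : J → J → J → ℕ)
      (hA : ∀ j i, ∑ l, w j i l + A j i = if j = i then 0 else h j * h i)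
      (hB : ∀ j l, ∑ i, w j i l + B j l = if j = l then 0 else h j * h l) (j : J) :
      ∑ l, B j l = ∑ i, A j i := by
    have h1 : ∑ i, (∑ l, w j i l + A j i) = ∑ l, (∑ i, w j i l + B j l) := by
      simp only [hA, hB]
    rw [sum_add_distrib, sum_add_distrib, sum_comm] at h1
    omega
  obtain ⟨U', V', X', r', c', s', hU', hV', hX', hr', hUr, hVr, hUc, hXc, hVs, hXs⟩ :=
    exists_three_splitting a h U V X r c s hr
      (fun j => by rw [hsum U V z hU hV, hr]) hc
      (fun i => by
        rw [hsum (fun i j => U j i) X (fun i j l => z j i l)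
          (fun i j => by rw [hU]; simp only [eq_comm, mul_comm]) hX, hc])
      hs
      (fun l => by
        rw [hsum (fun l j => V j l) (fun l i => X i l) (fun l j i => z j i l)
          (fun l j => by rw [hV]; simp only [eq_comm, mul_comm])
          (fun l j => by rw [hX]; simp only [eq_comm, mul_comm]), hs])
  have hcr (q : Fin 3) : ∑ j, c' q j = ∑ j, r' q j := by
    have h1 : ∑ j, (∑ i, U' q j i + r' q j) = ∑ i, (∑ j, U' q j i + c' q i) := by
      simp only [hUr, hUc]
    rw [sum_add_distrib, sum_add_distrib, sum_comm] at h1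
    omega
  have hsr (q : Fin 3) : ∑ j, s' q j = ∑ j, r' q j := by
    have h1 : ∑ j, (∑ i, V' q j i + r' q j) = ∑ i, (∑ j, V' q j i + s' q i) := by
      simp only [hVr, hVs]
    rw [sum_add_distrib, sum_add_distrib, sum_comm] at h1
    omega
  have hq (q : Fin 3) : ∑ j, r' q j ≤ a * a := by
    refine (sum_le_sum fun j _ => ?_).trans hle
    rw [← hr' j]
    exact single_le_sum (f := fun q => r' q j) (fun _ _ => Nat.zero_le _) (mem_univ q)
  refine ⟨completionArray a h z U' V' X' r' c' s' fun q => ∑ j, r' q j, ⟨?_, ?_, ?_⟩, ?_⟩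
  · rintro (p | j) (q | i) <;> rw [Fintype.sum_sum_type, Fin.sum_univ_three]
    · fin_cases p <;> fin_cases q <;> simp [completionArray, hsr, hq]
    · rw [Sum.elim_inl, Sum.elim_inr, ← hXc (p + 2)]
      fin_cases p <;> simp [completionArray, add_comm]
    · rw [Sum.elim_inl, Sum.elim_inr, mul_comm, ← hVr (q + 1)]
      fin_cases q <;> simp [completionArray, add_comm]
    · have := hU' j i
      rw [Fin.sum_univ_three] at this
      have hz := hU j i
      rcases eq_or_ne j i with rfl | hji
      · simp only [if_true] at hz
        simp [completionArray, sum_add_distrib, this]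
        omega
      · simp only [if_neg hji] at hz
        simp [completionArray, this, hji]
        omega
  · rintro (p | j) (q | i) <;> rw [Fintype.sum_sum_type, Fin.sum_univ_three]
    · fin_cases p <;> fin_cases q <;> simp [completionArray, hcr, hq]
    · rw [Sum.elim_inl, Sum.elim_inr, ← hXs (p + 2)]
      fin_cases p <;> simp [completionArray, add_comm]
    · rw [Sum.elim_inl, Sum.elim_inr, mul_comm, ← hUr q, add_comm _ (r' q j)]
      fin_cases q <;> simp [completionArray]
    · have := hV' j i
      rw [Fin.sum_univ_three] at this
      have hz := hV j i
      rcases eq_or_ne j i with rfl | hji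
      · simp only [if_true] at hz
        simp [completionArray, sum_add_distrib, ite_and]
        omega
      · simp only [if_neg hji] at hz
        simp [completionArray, sum_add_distrib, ite_and, hji]
        omega
  · rintro (p | j) (q | i) <;> rw [Fintype.sum_sum_type, Fin.sum_univ_three]
    · fin_cases p <;> fin_cases q <;> simp [completionArray, hq]
    · rw [Sum.elim_inl, Sum.elim_inr, ← hVs (p + 1)]
      fin_cases p <;> simp [completionArray, add_comm]
    · rw [Sum.elim_inl, Sum.elim_inr, mul_comm, ← hUc q]
      fin_cases q <;> simp [completionArray, add_comm]
    · have := hX' j i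
      rw [Fin.sum_univ_three] at this
      have hz := hX j i
      rcases eq_or_ne j i with rfl | hji
      · simp only [if_true] at hz
        simp [completionArray, sum_add_distrib]
        omega
      · simp only [if_neg hji] at hz
        simp [completionArray, hji]
        omega
  · rintro (p | j)
    · simp [completionArray]
    · have hz := hU j j
      rw [if_pos rfl] at hz
      have := single_le_sum (f := z j j) (fun _ _ => Nat.zero_le _) (mem_univ j)
      simp [completionArray]
      omega

section Triples

variable {J P T : Type*} [DecidableEq J] {h : J → ℕ} {pos : Finset P}
  {γ : P → J} {Z : Finset T} {row col : T → P}

/-- In a set of triples two of whose coordinates determine the triple, the number of triples with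
these coordinates in two given classes, together with some complement, is the product of the
class sizes. -/
theorem card_filter_add_sub (hγ : ∀ j, #{v ∈ pos | γ v = j} = h j)
    (hrow : ∀ t ∈ Z, row t ∈ pos) (hcol : ∀ t ∈ Z, col t ∈ pos)
    (hne : ∀ t ∈ Z, γ (row t) ≠ γ (col t))
    (hinj : ∀ t ∈ Z, ∀ t' ∈ Z, row t = row t' → col t = col t' → t = t') (j i : J) :
    #{t ∈ Z | γ (row t) = j ∧ γ (col t) = i} +
      ((if j = i then 0 else h j * h i) - #{t ∈ Z | γ (row t) = j ∧ γ (col t) = i}) =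
      if j = i then 0 else h j * h i := by
  refine Nat.add_sub_cancel' ?_
  split_ifs with hji
  · subst hji
    rw [Nat.le_zero, card_eq_zero, filter_eq_empty_iff]
    rintro t ht ⟨h1, h2⟩
    exact hne t ht (h1.trans h2.symm)
  · rw [← hγ j, ← hγ i, ← card_product]
    refine card_le_card_of_injOn (fun t => (row t, col t)) (fun t ht => ?_) fun t ht t' ht' htt => ?_
    · have := mem_filter.1 ht
      simp [this.2, hrow t this.1, hcol t this.1]
    · exact hinj t (mem_filter.1 ht).1 t' (mem_filter.1 ht').1 (Prod.ext_iff.1 htt).1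
        (Prod.ext_iff.1 htt).2

theorem mul_card_le_card_filter [DecidableEq P] {a : ℕ} (hγ : ∀ j, #{v ∈ pos | γ v = j} = h j)
    (hrow : ∀ t ∈ Z, row t ∈ pos)
    (hcard : ∀ v ∈ pos, #pos ≤ #{t ∈ Z | row t = v} + 3 * a + h (γ v)) (j : J) :
    h j * #pos ≤ #{t ∈ Z | γ (row t) = j} + h j * (3 * a + h j) := by
  have h1 : #{t ∈ Z | γ (row t) = j} = ∑ v ∈ pos with γ v = j, #{t ∈ Z | row t = v} := by
    rw [card_eq_sum_card_fiberwise (f := row) (t := {v ∈ pos | γ v = j})]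
    · refine sum_congr rfl fun v hv => ?_
      rw [filter_filter]
      congr 1
      ext t
      have := (mem_filter.1 hv).2
      simp only [mem_filter]
      constructor
      · tauto
      · rintro ⟨h1, rfl⟩
        exact ⟨h1, this, rfl⟩
    · intro t ht
      have := mem_filter.1 ht
      simp [this.2, hrow t this.1]
  have h2 : ∑ v ∈ pos with γ v = j, #pos ≤
      ∑ v ∈ pos with γ v = j, (#{t ∈ Z | row t = v} + (3 * a + h j)) := by
    refine sum_le_sum fun v hv => ?_
    obtain ⟨hv, hvj⟩ := mem_filter.1 hv
    have := hcard v hv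
    rw [hvj] at this
    omega
  rwa [sum_add_distrib, ← h1, sum_const, sum_const, hγ, smul_eq_mul, smul_eq_mul] at h2

theorem sum_add_sum_add_mul_self [Fintype J] {j : J} {N u : J → ℕ}
    (hN : ∀ i, N i + u i = if j = i then 0 else h j * h i) :
    ∑ i, u i + ∑ i, N i + h j * h j = h j * ∑ i, h i := by
  rw [← sum_add_distrib, mul_sum, ← sum_erase_add _ _ (mem_univ j),
    ← sum_erase_add (a := j) (f := fun i => h j * h i) _ (mem_univ j)]
  have h1 : u j + N j = 0 := by rw [add_comm, hN, if_pos rfl]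
  rw [h1, add_zero]
  congr 1
  refine sum_congr rfl fun i hi => ?_
  rw [add_comm, hN, if_neg (ne_of_mem_erase hi).symm]

theorem sum_card_filter_and [Fintype J] (A : T → Prop) [DecidablePred A] (f : T → J) :
    ∑ l, #{t ∈ Z | A t ∧ f t = l} = #{t ∈ Z | A t} := by
  rw [card_eq_sum_card_fiberwise (f := f) (t := univ) (by simp)]
  simp_rw [filter_filter]

/-- Triples of points, any two coordinates of which lie in different classes and determine the
triple, give an outline with three further classes of size `a` if every point occurs often enough
and there are not too many triples. -/
theorem hasOutline_of_triples [Fintype J] [DecidableEq P] {a : ℕ} {sym : T → P}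
    (hγ : ∀ j, #{v ∈ pos | γ v = j} = h j)
    (hrow : ∀ t ∈ Z, row t ∈ pos) (hcol : ∀ t ∈ Z, col t ∈ pos) (hsym : ∀ t ∈ Z, sym t ∈ pos)
    (hrc : ∀ t ∈ Z, γ (row t) ≠ γ (col t)) (hrs : ∀ t ∈ Z, γ (row t) ≠ γ (sym t))
    (hcs : ∀ t ∈ Z, γ (col t) ≠ γ (sym t))
    (irc : ∀ t ∈ Z, ∀ t' ∈ Z, row t = row t' → col t = col t' → t = t')
    (irs : ∀ t ∈ Z, ∀ t' ∈ Z, row t = row t' → sym t = sym t' → t = t')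
    (ics : ∀ t ∈ Z, ∀ t' ∈ Z, col t = col t' → sym t = sym t' → t = t')
    (nrow : ∀ v ∈ pos, #pos ≤ #{t ∈ Z | row t = v} + 3 * a + h (γ v))
    (ncol : ∀ v ∈ pos, #pos ≤ #{t ∈ Z | col t = v} + 3 * a + h (γ v))
    (nsym : ∀ v ∈ pos, #pos ≤ #{t ∈ Z | sym t = v} + 3 * a + h (γ v))
    (hZ : #Z + 3 * a * #pos + ∑ v ∈ pos, h (γ v) ≤ #pos * #pos + a * a) :
    HasOutline (Sum.elim (fun _ : Fin 3 => a) h) := by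
  have hpos : ∑ j, h j = #pos := by
    rw [card_eq_sum_card_fiberwise (f := γ) (t := univ) (by simp)]
    exact sum_congr rfl fun j _ => (hγ j).symm
  have hsq : ∑ v ∈ pos, h (γ v) = ∑ j, h j * h j := by
    rw [← sum_fiberwise pos γ]
    refine sum_congr rfl fun j _ => ?_
    rw [sum_congr rfl (g := fun _ => h j) (fun v hv => by rw [(mem_filter.1 hv).2]), sum_const, hγ,
      smul_eq_mul]
  have U := card_filter_add_sub hγ hrow hcol hrc irc
  have V := card_filter_add_sub hγ hrow hsym hrs irs
  have X := card_filter_add_sub hγ hcol hsym hcs ics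
  have slack {u w : ℕ} {j : J} (h1 : u + w + h j * h j = h j * #pos)
      (h2 : h j * #pos ≤ w + h j * (3 * a + h j)) : u + (3 * a * h j - u) = 3 * a * h j := by
    refine Nat.add_sub_cancel' ?_
    rw [mul_add, mul_comm (h j) (3 * a)] at h2
    omega
  have swap (f g : T → J) (j i : J) : #{t ∈ Z | f t = j ∧ g t = i} = #{t ∈ Z | g t = i ∧ f t = j} := by
    simp only [and_comm]
  have hswap (j i : J) : (if j = i then 0 else h j * h i) = if i = j then 0 else h i * h j := by
    simp only [eq_comm, mul_comm]
  have sU (j : J) := sum_add_sum_add_mul_self (U j)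
  have sU' (i : J) := sum_add_sum_add_mul_self (j := i) (fun j => (U j i).trans (hswap j i))
  have sV' (i : J) := sum_add_sum_add_mul_self (j := i) (fun j => (V j i).trans (hswap j i))
  simp only [sum_card_filter_and, hpos] at sU
  simp only [fun i => sum_congr (M := ℕ) (s₁ := univ) rfl fun j _ =>
    swap (fun t => γ (row t)) (fun t => γ (col t)) j i, sum_card_filter_and, hpos] at sU'
  simp only [fun i => sum_congr (M := ℕ) (s₁ := univ) rfl fun j _ =>
    swap (fun t => γ (row t)) (fun t => γ (sym t)) j i, sum_card_filter_and, hpos] at sV'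
  have zV (j l : J) : ∑ i, #{t ∈ Z | (γ (row t) = j ∧ γ (col t) = i) ∧ γ (sym t) = l} =
      #{t ∈ Z | γ (row t) = j ∧ γ (sym t) = l} := by
    simp only [and_right_comm (b := γ (col _) = _)]
    rw [sum_card_filter_and]
  have zX (i l : J) : ∑ j, #{t ∈ Z | (γ (row t) = j ∧ γ (col t) = i) ∧ γ (sym t) = l} =
      #{t ∈ Z | γ (col t) = i ∧ γ (sym t) = l} := by
    simp only [and_assoc, and_comm (a := γ (row _) = _)]
    simp only [← and_assoc]
    rw [sum_card_filter_and]
  refine hasOutline_of_partial a h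
    (fun j i l => #{t ∈ Z | (γ (row t) = j ∧ γ (col t) = i) ∧ γ (sym t) = l}) _ _ _ _ _ _
    (fun j i => Eq.trans (by rw [sum_card_filter_and]) (U j i))
    (fun j l => Eq.trans (by rw [zV]) (V j l)) (fun i l => Eq.trans (by rw [zX]) (X i l))
    (fun j => slack (sU j) (mul_card_le_card_filter hγ hrow nrow j))
    (fun j => slack (sU' j) (mul_card_le_card_filter hγ hcol ncol j))
    (fun j => slack (sV' j) (mul_card_le_card_filter hγ hsym nsym j)) ?_
  · have h1 := sum_congr (s₁ := univ) rfl fun j _ => sU j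
    have h2 := sum_congr (s₁ := univ) rfl fun j _ =>
      slack (sU j) (mul_card_le_card_filter hγ hrow nrow j)
    have h3 := sum_card_filter_and (Z := Z) (fun _ => True) (fun t => γ (row t))
    simp only [true_and, filter_true] at h3
    rw [sum_add_distrib, sum_add_distrib, h3, ← sum_mul, hpos] at h1
    rw [sum_add_distrib, ← mul_sum, hpos] at h2
    omega

end Triples

/-- `y` is the residue of `x` modulo `m`, for `x < 2 * m`. -/
def Wraps (m x y : ℕ) : Prop := y < m ∧ (y = x ∨ y + m = x)

/-- `2 * d` or, if this exceeds `m`, the odd one of `2 * d - m` and `2 * d - m + 1`. -/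
def IsShift (m b d e : ℕ) : Prop :=
  b ≤ d ∧ 2 * d + b ≤ m ∧ e = 2 * d ∨
    m + b ≤ 2 * d + (m + 1) % 2 ∧ d + 2 * b ≤ m ∧ e + m = 2 * d + (m + 1) % 2

/-- The triples `(x, y, z)` of residues modulo `m` of kind `k`, difference `d` and index `t`: kind
`0` has two large differences `d` and `e`; the other kinds have small differences `d` and `2 * d`,
and their indices `t` are confined to `c ≤ t`. -/
def IsTriple (m b c e k d t x y z : ℕ) : Prop :=
  k = 0 ∧ IsShift m b d e ∧ t < m ∧ x = t ∧ Wraps m (t + d) y ∧ Wraps m (t + e) z ∨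
  k = 1 ∧ (0 < d ∧ d < b ∧ c ≤ t ∧ t < m) ∧ x + d = t ∧ y = t ∧ Wraps m (t + d) z ∨
  k = 2 ∧ (0 < d ∧ d < b ∧ c ≤ t ∧ t < m ∧ t < c + d) ∧ Wraps m (t + d) x ∧ y + d = t ∧ z = t ∨
  k = 3 ∧ (0 < d ∧ d < b ∧ c ≤ t ∧ t < m ∧ m ≤ t + d ∧ (t < c + d ∨ c + d + d ≤ t)) ∧ x = t ∧
    Wraps m (t + d) y ∧ z + d = t

section IsTriple

variable {m b : ℕ} {c e : ℕ → ℕ} {k d t x y z k' d' t' x' y' z' : ℕ}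

theorem IsTriple.lt (h : IsTriple m b (c d) (e d) k d t x y z) : x < m ∧ y < m ∧ z < m := by
  unfold IsTriple Wraps at h
  omega

theorem IsTriple.eq_of_row_of_col (hb : 0 < b) (hm : 4 * b ≤ m) (hc : ∀ d < b, b ≤ c d)
    (h : IsTriple m b (c d) (e d) k d t x y z)
    (h' : IsTriple m b (c d') (e d') k' d' t' x' y' z') (hx : x = x') (hy : y = y') :
    (k, d, t) = (k', d', t') := by
  have hcd := hc d
  have hcd' := hc d'
  unfold IsTriple Wraps IsShift at h h'
  subst hx hy
  rcases h with ⟨rfl, h⟩ | ⟨rfl, h⟩ | ⟨rfl, h⟩ | ⟨rfl, h⟩ <;>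
  rcases h' with ⟨rfl, h'⟩ | ⟨rfl, h'⟩ | ⟨rfl, h'⟩ | ⟨rfl, h'⟩ <;>
  · obtain rfl : d = d' := by omega
    simp only [Prod.mk.injEq, true_and]
    omega

theorem IsTriple.eq_of_row_of_sym (hb : 0 < b) (hm : 4 * b ≤ m) (hc : ∀ d < b, b ≤ c d)
    (h : IsTriple m b (c d) (e d) k d t x y z)
    (h' : IsTriple m b (c d') (e d') k' d' t' x' y' z') (hx : x = x') (hz : z = z') :
    (k, d, t) = (k', d', t') := by
  have hcd := hc d
  have hcd' := hc d'
  unfold IsTriple Wraps IsShift at h h'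
  subst hx hz
  rcases h with ⟨rfl, h⟩ | ⟨rfl, h⟩ | ⟨rfl, h⟩ | ⟨rfl, h⟩ <;>
  rcases h' with ⟨rfl, h'⟩ | ⟨rfl, h'⟩ | ⟨rfl, h'⟩ | ⟨rfl, h'⟩ <;>
  · obtain rfl : d = d' := by omega
    simp only [Prod.mk.injEq, true_and]
    omega

theorem IsTriple.eq_of_col_of_sym (hb : 0 < b) (hm : 4 * b ≤ m) (hc : ∀ d < b, b ≤ c d)
    (h : IsTriple m b (c d) (e d) k d t x y z)
    (h' : IsTriple m b (c d') (e d') k' d' t' x' y' z') (hy : y = y') (hz : z = z') :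
    (k, d, t) = (k', d', t') := by
  have hcd := hc d
  have hcd' := hc d'
  unfold IsTriple Wraps IsShift at h h'
  subst hy hz
  rcases h with ⟨rfl, h⟩ | ⟨rfl, h⟩ | ⟨rfl, h⟩ | ⟨rfl, h⟩ <;>
  rcases h' with ⟨rfl, h'⟩ | ⟨rfl, h'⟩ | ⟨rfl, h'⟩ | ⟨rfl, h'⟩ <;>
  · obtain rfl : d = d' := by omega
    simp only [Prod.mk.injEq, true_and]
    omega

end IsTriple

theorem wraps_mod {m x : ℕ} (hx : x < 2 * m) : Wraps m x (x % m) := by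
  rcases lt_or_ge x m with h | h
  · rw [Nat.mod_eq_of_lt h]
    exact ⟨h, Or.inl rfl⟩
  · rw [Nat.mod_eq_sub_mod h, Nat.mod_eq_of_lt (by omega)]
    exact ⟨by omega, Or.inr (by omega)⟩

theorem Wraps.mod_eq {m x y : ℕ} (h : Wraps m x y) : x % m = y := by
  obtain ⟨hy, rfl | rfl⟩ := h
  · exact Nat.mod_eq_of_lt hy
  · rw [Nat.add_mod_right, Nat.mod_eq_of_lt hy]

/-- The second difference of the triples of kind `0` with first difference `d`. -/
def secondShift (m d : ℕ) : ℕ := if 2 * d < m then 2 * d else 2 * d - m + (m + 1) % 2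

/-- The row of the triple of kind `k`, difference `d` and index `t`. -/
def tripleRow (m : ℕ) : ℕ × ℕ × ℕ → ℕ
  | (1, d, t) => t - d
  | (2, d, t) => (t + d) % m
  | (_, _, t) => t

/-- The column of the triple of kind `k`, difference `d` and index `t`. -/
def tripleCol (m : ℕ) : ℕ × ℕ × ℕ → ℕ
  | (1, _, t) => t
  | (2, d, t) => t - d
  | (_, d, t) => (t + d) % m

/-- The symbol of the triple of kind `k`, difference `d` and index `t`. -/
def tripleSym (m : ℕ) : ℕ × ℕ × ℕ → ℕ
  | (0, d, t) => (t + secondShift m d) % m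
  | (1, d, t) => (t + d) % m
  | (2, _, t) => t
  | (_, d, t) => t - d

/-- The indices of the triples, with large differences taken from `D`. -/
def tripleIndices (m b : ℕ) (c : ℕ → ℕ) (D : Finset ℕ) : Finset (ℕ × ℕ × ℕ) :=
  {τ ∈ range 4 ×ˢ range m ×ˢ range m | τ.1 = 0 ∧ τ.2.1 ∈ D ∨
    (0 < τ.2.1 ∧ τ.2.1 < b ∧ c τ.2.1 ≤ τ.2.2) ∧ (τ.1 = 1 ∨ τ.1 = 2 ∧ τ.2.2 < c τ.2.1 + τ.2.1 ∨
      τ.1 = 3 ∧ m ≤ τ.2.2 + τ.2.1 ∧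
        (τ.2.2 < c τ.2.1 + τ.2.1 ∨ c τ.2.1 + τ.2.1 + τ.2.1 ≤ τ.2.2))}

section TripleIndices

variable {m b : ℕ} {c : ℕ → ℕ} {D : Finset ℕ} {k d t : ℕ}

theorem mem_tripleIndices : (k, d, t) ∈ tripleIndices m b c D ↔
    (k < 4 ∧ d < m ∧ t < m) ∧ (k = 0 ∧ d ∈ D ∨ (0 < d ∧ d < b ∧ c d ≤ t) ∧ (k = 1 ∨
      k = 2 ∧ t < c d + d ∨ k = 3 ∧ m ≤ t + d ∧ (t < c d + d ∨ c d + d + d ≤ t))) := by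
  simp [tripleIndices]

theorem isTriple_of_mem (hb : 0 < b) (hc : ∀ d < b, b ≤ c d)
    (hD : ∀ d ∈ D, IsShift m b d (secondShift m d))
    (hmem : (k, d, t) ∈ tripleIndices m b c D) :
    IsTriple m b (c d) (secondShift m d) k d t (tripleRow m (k, d, t)) (tripleCol m (k, d, t))
      (tripleSym m (k, d, t)) := by
  obtain ⟨⟨-, hd, ht⟩, ⟨rfl, hdD⟩ | ⟨hdt, h⟩⟩ := mem_tripleIndices.1 hmem
  · have he := hD d hdD
    have : secondShift m d < m := by
      unfold IsShift at he
      omega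
    exact Or.inl ⟨rfl, he, ht, rfl, wraps_mod (by omega), wraps_mod (by omega)⟩
  · have hw := wraps_mod (m := m) (x := t + d) (by omega)
    have := hc d hdt.2.1
    have htd : t - d + d = t := by omega
    rcases h with rfl | ⟨rfl, h⟩ | ⟨rfl, h⟩
    · exact Or.inr (Or.inl ⟨rfl, ⟨hdt.1, hdt.2.1, hdt.2.2, ht⟩, htd, rfl, hw⟩)
    · exact Or.inr (Or.inr (Or.inl ⟨rfl, ⟨hdt.1, hdt.2.1, hdt.2.2, ht, h⟩, hw, htd, rfl⟩))
    · exact Or.inr (Or.inr (Or.inr ⟨rfl, ⟨hdt.1, hdt.2.1, hdt.2.2, ht, h⟩, rfl, hw, htd⟩))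

theorem card_add_le_of_exists {F : Finset (ℕ × ℕ × ℕ)} {s : ℕ} (hDb : ∀ d ∈ D, b ≤ d)
    (h0 : ∀ d ∈ D, ∃ k t, (k, d, t) ∈ F) (h1 : ∀ d, s ≤ d → d < b → ∃ k t, (k, d, t) ∈ F) :
    #D + (b - s) ≤ #F := by
  rw [← Nat.card_Ico, ← card_union_of_disjoint]
  · refine (card_le_card fun d hd => ?_).trans (card_image_le (f := fun τ => τ.2.1))
    obtain ⟨k, t, h⟩ : ∃ k t, (k, d, t) ∈ F := by
      rcases mem_union.1 hd with hd | hd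
      · exact h0 d hd
      · exact h1 d (mem_Ico.1 hd).1 (mem_Ico.1 hd).2
    exact mem_image_of_mem _ h
  · refine disjoint_left.2 fun d hd hd' => ?_
    exact (hDb d hd).not_gt (mem_Ico.1 hd').2

variable {s v : ℕ}

theorem card_le_card_filter_tripleRow (hm : 4 * b ≤ m) (hv : v < m) (hs : 0 < s)
    (hc : ∀ d < b, b ≤ c d) (hsv : ∀ d, s ≤ d → c d ≤ v) (hDm : ∀ d ∈ D, b ≤ d ∧ d < m) :
    #D + (b - s) ≤ #{τ ∈ tripleIndices m b c D | tripleRow m τ = v} := by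
  refine card_add_le_of_exists (fun d hd => (hDm d hd).1) (fun d hd => ⟨0, v, ?_⟩)
    fun d hsd hdb => ?_
  · have := (hDm d hd).2
    exact mem_filter.2 ⟨mem_tripleIndices.2 (by tauto), rfl⟩
  · have h1 := hc d hdb
    have h2 := hsv d hsd
    rcases lt_or_ge (v + d) m with h | h
    · refine ⟨1, v + d, mem_filter.2 ⟨mem_tripleIndices.2 (by omega), ?_⟩⟩
      simp [tripleRow]
    · by_cases h3 : c d ≤ v - d ∧ v - d < c d + d
      · refine ⟨2, v - d, mem_filter.2 ⟨mem_tripleIndices.2 (by omega), ?_⟩⟩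
        exact Wraps.mod_eq ⟨hv, by omega⟩
      · exact ⟨3, v, mem_filter.2 ⟨mem_tripleIndices.2 (by omega), rfl⟩⟩

theorem card_le_card_filter_tripleCol (hbm : b ≤ m) (hv : v < m) (hs : 0 < s)
    (hsv : ∀ d, s ≤ d → c d ≤ v) (hDm : ∀ d ∈ D, b ≤ d ∧ d < m) :
    #D + (b - s) ≤ #{τ ∈ tripleIndices m b c D | tripleCol m τ = v} := by
  refine card_add_le_of_exists (fun d hd => (hDm d hd).1) (fun d hd => ?_) fun d hsd hdb => ?_
  · have := (hDm d hd).2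
    refine ⟨0, if d ≤ v then v - d else v + m - d, mem_filter.2 ⟨mem_tripleIndices.2 ?_, ?_⟩⟩
    · exact ⟨by split_ifs <;> omega, by tauto⟩
    · refine Wraps.mod_eq ⟨hv, ?_⟩
      split_ifs <;> omega
  · have := hsv d hsd
    exact ⟨1, v, mem_filter.2 ⟨mem_tripleIndices.2 (by omega), rfl⟩⟩

theorem card_le_card_filter_tripleSym (hv : v < m) (hs : 0 < s) (hc : ∀ d < b, b ≤ c d)
    (hsv : ∀ d, s ≤ d → c d ≤ v) (hDm : ∀ d ∈ D, b ≤ d ∧ d < m ∧ secondShift m d < m) :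
    #D + (b - s) ≤ #{τ ∈ tripleIndices m b c D | tripleSym m τ = v} := by
  refine card_add_le_of_exists (fun d hd => (hDm d hd).1) (fun d hd => ?_) fun d hsd hdb => ?_
  · have := (hDm d hd).2
    generalize hw : (if secondShift m d ≤ v then v - secondShift m d
      else v + m - secondShift m d) = w
    refine ⟨0, w, mem_filter.2 ⟨mem_tripleIndices.2 ?_, ?_⟩⟩
    · refine ⟨?_, by tauto⟩
      split_ifs at hw <;> omega
    · refine Wraps.mod_eq ⟨hv, ?_⟩
      split_ifs at hw <;> omega
  · have := hsv d hsd
    have := hc d hdb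
    by_cases h : c d ≤ v - d
    · refine ⟨1, v - d, mem_filter.2 ⟨mem_tripleIndices.2 (by omega), ?_⟩⟩
      exact Wraps.mod_eq ⟨hv, by omega⟩
    · exact ⟨2, v, mem_filter.2 ⟨mem_tripleIndices.2 (by omega), rfl⟩⟩

theorem card_tripleIndices_le : #(tripleIndices m b c D) ≤
    #D * m + ∑ d ∈ Ico 1 b, ((m - c d) + (d + d)) := by
  have hsub : tripleIndices m b c D ⊆ (D ×ˢ range m).image (Prod.mk 0) ∪
      (Ico 1 b).biUnion fun d => (Ico (c d) m).image (fun t => (1, d, t)) ∪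
        ((Ico (c d) (c d + d)).image (fun t => (2, d, t)) ∪
          (Ico (m - d) m).image (fun t => (3, d, t))) := by
    rintro ⟨k, d, t⟩ h
    obtain ⟨⟨-, hd, ht⟩, ⟨rfl, hdD⟩ | ⟨hdt, h⟩⟩ := mem_tripleIndices.1 h
    · exact mem_union_left _ (mem_image_of_mem _ (by simp [hdD, ht]))
    · refine mem_union_right _ (mem_biUnion.2 ⟨d, mem_Ico.2 (by omega), ?_⟩)
      rcases h with rfl | ⟨rfl, h⟩ | ⟨rfl, h⟩
      · exact mem_union_left _ (mem_image_of_mem _ (mem_Ico.2 (by omega)))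
      · exact mem_union_right _ (mem_union_left _ (mem_image_of_mem _ (mem_Ico.2 (by omega))))
      · exact mem_union_right _ (mem_union_right _ (mem_image_of_mem _ (mem_Ico.2 (by omega))))
  refine (card_le_card hsub).trans ((card_union_le _ _).trans (add_le_add ?_ ?_))
  · refine card_image_le.trans_eq ?_
    rw [card_product, card_range]
  · refine card_biUnion_le.trans (sum_le_sum fun d _ => ?_)
    refine (card_union_le _ _).trans (add_le_add ?_ ((card_union_le _ _).trans (add_le_add ?_ ?_)))
    · exact card_image_le.trans_eq (Nat.card_Ico _ _)
    · refine card_image_le.trans ?_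
      rw [Nat.card_Ico]
      omega
    · refine card_image_le.trans ?_
      rw [Nat.card_Ico]
      omega

end TripleIndices

section Positions

variable {J : Type*} {h : J → ℕ} {γ : ℕ → J} {m b : ℕ}

theorem ne_of_add_le_or_add_le (hdist : ∀ x y, x < y → y < m → γ x = γ y → y < x + h (γ x))
    {x y : ℕ} (hx : x < m) (hy : y < m)
    (hxy : x + h (γ x) ≤ y ∧ x < y ∨ y + h (γ x) ≤ x ∧ y < x) : γ x ≠ γ y := by
  intro hγ
  rcases hxy with hxy | hxy
  · have := hdist x y hxy.2 hy hγ
    omega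
  · have := hdist y x hxy.2 hx hγ.symm
    rw [← hγ] at this
    omega

/-- The coordinates of a triple lie in different classes. -/
theorem IsTriple.ne {c e k d t x y z : ℕ} (hb : 0 < b) (hm : 4 * b ≤ m)
    (hdist : ∀ x y, x < y → y < m → γ x = γ y → y < x + h (γ x))
    (hanti : ∀ x y, x ≤ y → y < m → h (γ y) ≤ h (γ x)) (hle : ∀ x < m, h (γ x) ≤ b)
    (hc : ∀ t < m, h (γ t) ≤ d ↔ c ≤ t) (hxyz : IsTriple m b c e k d t x y z) :
    γ x ≠ γ y ∧ γ x ≠ γ z ∧ γ y ≠ γ z := by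
  have hne : ∀ {x y}, x < m → y < m →
      (x + h (γ x) ≤ y ∧ x < y ∨ y + h (γ x) ≤ x ∧ y < x) → γ x ≠ γ y :=
    ne_of_add_le_or_add_le hdist
  have hx := hle x
  have hy := hle y
  have hz := hle z
  have hlt : x < m ∧ y < m ∧ z < m := by
    unfold IsTriple Wraps at hxyz
    omega
  obtain ⟨hxm, hym, hzm⟩ := hlt
  unfold IsTriple Wraps IsShift at hxyz
  rcases hxyz with ⟨rfl, h0⟩ | ⟨rfl, h0⟩ | ⟨rfl, h0⟩ | ⟨rfl, h0⟩
  · exact ⟨hne hxm hym (by omega), hne hxm hzm (by omega), hne hym hzm (by omega)⟩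
  · have ht := (hc t (by omega)).2 (by omega)
    have htz := hanti t z
    obtain rfl := h0.2.2.1
    exact ⟨(hne hym hxm (by omega)).symm, (hne hzm hxm (by omega)).symm, hne hym hzm (by omega)⟩
  · have ht := (hc t (by omega)).2 (by omega)
    have htx := hanti t x
    obtain rfl := h0.2.2.2
    exact ⟨hne hxm hym (by omega), (hne hzm hxm (by omega)).symm, (hne hzm hym (by omega)).symm⟩
  · have ht := (hc t (by omega)).2 (by omega)
    have hty := hanti t y
    obtain rfl := h0.2.1
    exact ⟨hne hxm hym (by omega), hne hxm hzm (by omega), hne hym hzm (by omega)⟩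

/-- A nonincreasing function on `{0, …, m - 1}` is at most `d` from some threshold on. -/
theorem exists_threshold {σ : ℕ → ℕ} (hσ : ∀ x y, x ≤ y → y < m → σ y ≤ σ x) (d : ℕ) :
    ∃ c ≤ m, ∀ t < m, σ t ≤ d ↔ c ≤ t := by
  classical
  have hex : ∃ t, m ≤ t ∨ σ t ≤ d := ⟨m, Or.inl le_rfl⟩
  refine ⟨Nat.find hex, Nat.find_le (Or.inl le_rfl), fun t ht => ⟨fun h => ?_, fun h => ?_⟩⟩
  · exact Nat.find_le (Or.inr h)
  · rcases Nat.find_spec hex with h' | h'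
    · omega
    · exact (hσ _ _ h ht).trans h'

theorem exists_shifts {a : ℕ} (hb : 0 < b) (hba : b ≤ a) (hm : 3 * a + b ≤ m) :
    ∃ D : Finset ℕ, #D = m - 3 * a - b ∧ ∀ d ∈ D, IsShift m b d (secondShift m d) := by
  have hdisj : Disjoint (Ico b ((m - b) / 2 + 1))
      (Ico ((m + b + 1 - (m + 1) % 2) / 2) (m - 2 * b + 1)) := by
    refine disjoint_left.2 fun d hd hd' => ?_
    rw [mem_Ico] at hd hd'
    omega
  obtain ⟨D, hD, hcard⟩ := exists_subset_card_eq (n := m - 3 * a - b)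
    (s := Ico b ((m - b) / 2 + 1) ∪ Ico ((m + b + 1 - (m + 1) % 2) / 2) (m - 2 * b + 1)) (by
      rw [card_union_of_disjoint hdisj, Nat.card_Ico, Nat.card_Ico]
      omega)
  refine ⟨D, hcard, fun d hd => ?_⟩
  have := hD hd
  rw [mem_union, mem_Ico, mem_Ico] at this
  unfold IsShift secondShift
  split_ifs <;> omega

theorem sum_threshold_add_sum_le {σ c : ℕ → ℕ} (hle : ∀ x < m, σ x ≤ b)
    (hc : ∀ d, ∀ t < m, σ t ≤ d ↔ c d ≤ t) :
    ∑ d ∈ Ico 1 b, (m - c d) + ∑ v ∈ range m, σ v ≤ m * b := by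
  have h1 : ∑ d ∈ Ico 1 b, (m - c d) ≤ ∑ v ∈ range m, (b - σ v) := by
    calc ∑ d ∈ Ico 1 b, (m - c d) = ∑ d ∈ Ico 1 b, #{v ∈ range m | σ v ≤ d} := by
          refine sum_congr rfl fun d _ => ?_
          rw [← Nat.card_Ico]
          congr 1
          ext v
          have := hc d v
          simp only [mem_Ico, mem_filter, mem_range]
          tauto
      _ = ∑ v ∈ range m, #{d ∈ Ico 1 b | σ v ≤ d} :=
          sum_card_bipartiteAbove_eq_sum_card_bipartiteBelow _
      _ ≤ ∑ v ∈ range m, (b - σ v) := by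
          refine sum_le_sum fun v _ => ?_
          rw [← Nat.card_Ico]
          refine card_le_card fun d hd => ?_
          simp only [mem_filter, mem_Ico] at hd ⊢
          omega
  calc _ ≤ ∑ v ∈ range m, (b - σ v) + ∑ v ∈ range m, σ v := by gcongr
    _ = ∑ v ∈ range m, b := by
        rw [← sum_add_distrib]
        exact sum_congr rfl fun v hv => Nat.sub_add_cancel (hle v (mem_range.1 hv))
    _ = m * b := by simp

theorem hasOutline_of_positions [Fintype J] [DecidableEq J] {a : ℕ} (hb : 0 < b) (hba : b ≤ a)
    (hm : 3 * a + b ≤ m) (hγ : ∀ j, #{v ∈ range m | γ v = j} = h j)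
    (hdist : ∀ x y, x < y → y < m → γ x = γ y → y < x + h (γ x))
    (hanti : ∀ x y, x ≤ y → y < m → h (γ y) ≤ h (γ x)) (hle : ∀ x < m, h (γ x) ≤ b)
    (hfirst : ∀ x < b, h (γ x) = b) :
    HasOutline (Sum.elim (fun _ : Fin 3 => a) h) := by
  choose c hcm hc using exists_threshold (m := m) (σ := fun v => h (γ v)) hanti
  have hcb : ∀ d < b, b ≤ c d := by
    intro d hd
    by_contra! hcd
    have h1 := (hc d (c d) (by omega)).2 le_rfl
    have h2 := hfirst (c d) hcd
    omega
  obtain ⟨D, hcard, hD⟩ := exists_shifts hb hba hm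
  have hm4 : 4 * b ≤ m := by omega
  have hDm : ∀ d ∈ D, b ≤ d ∧ d < m ∧ secondShift m d < m := by
    intro d hd
    have := hD d hd
    unfold IsShift at this
    omega
  have hpos : ∀ v < m, 0 < h (γ v) := by
    intro v hv
    rw [← hγ, card_pos]
    exact ⟨v, by simp [hv]⟩
  have hT : ∀ τ ∈ tripleIndices m b c D, IsTriple m b (c τ.2.1) (secondShift m τ.2.1) τ.1 τ.2.1
      τ.2.2 (tripleRow m τ) (tripleCol m τ) (tripleSym m τ) :=
    fun τ hτ => isTriple_of_mem hb hcb hD hτ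
  have hlt := fun τ hτ => (hT τ hτ).lt
  have hne := fun τ hτ => (hT τ hτ).ne hb hm4 hdist hanti hle (hc _)
  have hadd : ∀ {n v}, #D + (b - h (γ v)) ≤ n → v < m → m ≤ n + 3 * a + h (γ v) := by
    intro n v h1 hv
    have := hle v hv
    omega
  refine hasOutline_of_triples (pos := range m) (Z := tripleIndices m b c D) (row := tripleRow m)
    (col := tripleCol m) (sym := tripleSym m) hγ (fun τ hτ => mem_range.2 (hlt τ hτ).1)
    (fun τ hτ => mem_range.2 (hlt τ hτ).2.1) (fun τ hτ => mem_range.2 (hlt τ hτ).2.2)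
    (fun τ hτ => (hne τ hτ).1) (fun τ hτ => (hne τ hτ).2.1) (fun τ hτ => (hne τ hτ).2.2)
    (fun τ hτ τ' hτ' => (hT τ hτ).eq_of_row_of_col hb hm4 hcb (hT τ' hτ'))
    (fun τ hτ τ' hτ' => (hT τ hτ).eq_of_row_of_sym hb hm4 hcb (hT τ' hτ'))
    (fun τ hτ τ' hτ' => (hT τ hτ).eq_of_col_of_sym hb hm4 hcb (hT τ' hτ'))
    (fun v hv => ?_) (fun v hv => ?_) (fun v hv => ?_) ?_
  · rw [card_range]
    rw [mem_range] at hv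
    exact hadd (card_le_card_filter_tripleRow hm4 hv (hpos v hv) hcb
      (fun d hd => (hc d v hv).1 hd) fun d hd => ⟨(hDm d hd).1, (hDm d hd).2.1⟩) hv
  · rw [card_range]
    rw [mem_range] at hv
    exact hadd (card_le_card_filter_tripleCol (by omega) hv (hpos v hv)
      (fun d hd => (hc d v hv).1 hd) fun d hd => ⟨(hDm d hd).1, (hDm d hd).2.1⟩) hv
  · rw [card_range]
    rw [mem_range] at hv
    exact hadd (card_le_card_filter_tripleSym hv (hpos v hv) hcb
      (fun d hd => (hc d v hv).1 hd) hDm) hv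
  · rw [card_range]
    have h1 := card_tripleIndices_le (m := m) (b := b) (c := c) (D := D)
    have h2 := sum_threshold_add_sum_le hle hc
    have h3 : ∑ d ∈ Ico 1 b, (d + d) ≤ b * b := by
      calc ∑ d ∈ Ico 1 b, (d + d) ≤ ∑ d ∈ range b, (d + d) :=
            sum_le_sum_of_subset fun d hd => mem_range.2 (mem_Ico.1 hd).2
        _ = b * (b - 1) := by rw [← sum_range_id_mul_two, sum_mul]; simp only [mul_two]
        _ ≤ b * b := Nat.mul_le_mul_left b (Nat.sub_le b 1)
    have h4 : b * b ≤ a * a := Nat.mul_le_mul hba hba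
    obtain ⟨n, rfl⟩ := Nat.exists_eq_add_of_le hm
    have h5 : #D = n := by omega
    rw [sum_add_distrib, h5] at h1
    nlinarith

end Positions

theorem exists_sum_range_le_and_lt {g : ℕ → ℕ} {n v : ℕ} (hv : v < ∑ i ∈ range n, g i) :
    ∃ j < n, ∑ i ∈ range j, g i ≤ v ∧ v < ∑ i ∈ range (j + 1), g i := by
  induction n with
  | zero => simp at hv
  | succ n ih =>
    rcases lt_or_ge v (∑ i ∈ range n, g i) with h | h
    · obtain ⟨j, hj, hjv⟩ := ih h
      exact ⟨j, by omega, hjv⟩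
    · exact ⟨n, by omega, h, hv⟩

theorem hasOutline_of_le_sum {n a : ℕ} {g : ℕ → ℕ} (hg : ∀ i j, i ≤ j → j < n → g j ≤ g i)
    (h0 : 0 < g 0) (h0a : g 0 ≤ a) (hsum : 3 * a + g 0 ≤ ∑ i ∈ range n, g i) :
    HasOutline (Sum.elim (fun _ : Fin 3 => a) fun j : Fin n => g j) := by
  have hn : 0 < n := by
    rcases n.eq_zero_or_pos with rfl | hn
    · simp only [range_zero, sum_empty] at hsum
      omega
    · exact hn
  have hS : ∀ {i j}, i ≤ j → ∑ i ∈ range i, g i ≤ ∑ i ∈ range j, g i := fun hij =>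
    sum_le_sum_of_subset (range_subset_range.2 hij)
  have hex : ∀ v, ∃ j : Fin n, v < ∑ i ∈ range n, g i →
      ∑ i ∈ range j, g i ≤ v ∧ v < ∑ i ∈ range (j + 1), g i := by
    intro v
    by_cases hv : v < ∑ i ∈ range n, g i
    · obtain ⟨j, hj, hjv⟩ := exists_sum_range_le_and_lt hv
      exact ⟨⟨j, hj⟩, fun _ => hjv⟩
    · exact ⟨⟨0, hn⟩, fun h => absurd h hv⟩
  choose γ hγ using hex
  have hmono : ∀ {x y}, x ≤ y → y < ∑ i ∈ range n, g i → (γ x : ℕ) ≤ γ y := by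
    intro x y hxy hy
    by_contra! hlt
    have h1 := hγ x (by omega)
    have h2 := hγ y hy
    have h3 := hS (Nat.succ_le_of_lt hlt)
    rw [Nat.succ_eq_add_one] at h3
    omega
  have hγ_iff : ∀ {v}, v < ∑ i ∈ range n, g i → ∀ j : Fin n, γ v = j ↔
      ∑ i ∈ range j, g i ≤ v ∧ v < ∑ i ∈ range (j + 1), g i := by
    refine fun {v} hv j => ⟨fun h => h ▸ hγ v hv, fun h => ?_⟩
    have h1 := hγ v hv
    rcases lt_trichotomy (γ v : ℕ) j with hlt | heq | hlt
    · have := hS (Nat.succ_le_of_lt hlt)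
      rw [Nat.succ_eq_add_one] at this
      omega
    · exact Fin.ext heq
    · have := hS (Nat.succ_le_of_lt hlt)
      rw [Nat.succ_eq_add_one] at this
      omega
  refine hasOutline_of_positions (γ := γ) h0 h0a hsum (fun j => ?_) (fun x y hxy hy hxy' => ?_)
    (fun x y hxy hy => hg _ _ (hmono hxy hy) (γ y).2) (fun x _ => hg _ _ (Nat.zero_le _) (γ x).2)
    fun x hx => ?_
  · have : ({v ∈ range (∑ i ∈ range n, g i) | γ v = j} : Finset ℕ) =
        Ico (∑ i ∈ range j, g i) (∑ i ∈ range (j + 1), g i) := by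
      ext v
      rw [mem_filter, mem_range, mem_Ico]
      have hle := hS (Nat.succ_le_of_lt j.2)
      rw [Nat.succ_eq_add_one] at hle
      exact ⟨fun h => (hγ_iff h.1 j).1 h.2, fun h => ⟨h.2.trans_le hle,
        (hγ_iff (h.2.trans_le hle) j).2 h⟩⟩
    rw [this, Nat.card_Ico, sum_range_succ, Nat.add_sub_cancel_left]
  · have h1 := (hγ x (by omega)).1
    have h2 := (hγ y hy).2
    rw [← hxy', sum_range_succ] at h2
    omega
  · have : γ x = ⟨0, hn⟩ := (hγ_iff (by omega) _).2 (by simpa using hx)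
    rw [this]

/-- A tensor with zero pair sums on the diagonal, pair sums at most `e` elsewhere, and total `n` in
every layer. -/
def IsPartialTensor {U : Type*} [Fintype U] [DecidableEq U] (e n : ℕ) (F : U → U → U → ℕ) : Prop :=
  (∀ p q, ∑ r, F p q r ≤ if p = q then 0 else e) ∧
  (∀ p r, ∑ q, F p q r ≤ if p = r then 0 else e) ∧
  (∀ q r, ∑ p, F p q r ≤ if q = r then 0 else e) ∧
  (∀ p, ∑ q, ∑ r, F p q r = n) ∧ (∀ q, ∑ p, ∑ r, F p q r = n) ∧ ∀ r, ∑ p, ∑ q, F p q r = n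

instance {U : Type*} [Fintype U] [DecidableEq U] (e n : ℕ) (F : U → U → U → ℕ) :
    Decidable (IsPartialTensor e n F) := by
  unfold IsPartialTensor
  infer_instance

/-- The indicator of the symbols `L p q` in the off-diagonal cells of class at most `n`. -/
def cellTensor {u : ℕ} (cls L : Fin u → Fin u → Fin u) (n : ℕ)
    (p q r : Fin u) : ℕ :=
  if p ≠ q ∧ (cls p q : ℕ) ≤ n ∧ L p q = r then 1 else 0

theorem exists_isPartialTensor_one {u n : ℕ} (hu : 3 ≤ u) (hu' : u ≤ 6) (hn : n < u) :
    ∃ F : Fin u → Fin u → Fin u → ℕ, IsPartialTensor 1 n F := by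
  interval_cases u
  · refine ⟨cellTensor (fun p q => q - p) (fun p q => -(p + q)) n, ?_⟩
    interval_cases n <;> decide +kernel
  · refine ⟨cellTensor (fun p q => p ^^^ q) (fun p q => p ^^^ ![0, 2, 3, 1] (p ^^^ q)) n, ?_⟩
    interval_cases n <;> decide +kernel
  · refine ⟨cellTensor (fun p q => q - p) (fun p q => 3 * (p + q)) n, ?_⟩
    interval_cases n <;> decide +kernel
  · rcases (Nat.le_of_lt_succ hn).lt_or_eq with hn | rfl
    · refine ⟨cellTensor (fun p q => q - p) (fun p q => p + ![0, 2, 4, 1, 3, 0] (q - p)) n, ?_⟩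
      interval_cases n <;> decide +kernel
    · refine ⟨cellTensor (fun p q => q - p) ![![0, 2, 1, 4, 5, 3], ![2, 1, 3, 5, 0, 4],
        ![4, 5, 2, 0, 3, 1], ![1, 4, 5, 3, 2, 0], ![5, 3, 0, 1, 4, 2], ![3, 0, 4, 2, 1, 5]] 5, ?_⟩
      decide +kernel

theorem IsPartialTensor.add {U : Type*} [Fintype U] [DecidableEq U] {e n e' n' : ℕ}
    {F F' : U → U → U → ℕ} (h : IsPartialTensor e n F) (h' : IsPartialTensor e' n' F') :
    IsPartialTensor (e + e') (n + n') fun p q r => F p q r + F' p q r := by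
  have hite : ∀ p q : U, (if p = q then 0 else e + e') =
      (if p = q then 0 else e) + if p = q then 0 else e' := by
    intro p q
    split_ifs <;> rfl
  simp only [IsPartialTensor, sum_add_distrib, hite]
  exact ⟨fun p q => add_le_add (h.1 p q) (h'.1 p q),
    fun p q => add_le_add (h.2.1 p q) (h'.2.1 p q),
    fun p q => add_le_add (h.2.2.1 p q) (h'.2.2.1 p q),
    fun p => by rw [h.2.2.2.1, h'.2.2.2.1], fun p => by rw [h.2.2.2.2.1, h'.2.2.2.2.1],
    fun p => by rw [h.2.2.2.2.2, h'.2.2.2.2.2]⟩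

theorem exists_isPartialTensor {u e n : ℕ} (hu : 3 ≤ u) (hu' : u ≤ 6) (hn : n ≤ e * (u - 1)) :
    ∃ F : Fin u → Fin u → Fin u → ℕ, IsPartialTensor e n F := by
  induction e generalizing n with
  | zero =>
    obtain rfl : n = 0 := by omega
    exact ⟨fun _ _ _ => 0, by simp [IsPartialTensor]⟩
  | succ e ih =>
    rw [add_one_mul] at hn
    obtain ⟨F, hF⟩ := ih (n := n - min n (u - 1)) (by omega)
    obtain ⟨F', hF'⟩ := exists_isPartialTensor_one hu hu' (n := min n (u - 1)) (by omega)
    have := hF.add hF'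
    rw [Nat.sub_add_cancel (min_le_left _ _)] at this
    exact ⟨_, this⟩

/-- The increments of an outline when the first weights increase by one. -/
def incrementArray {U J : Type*} [DecidableEq U] (e : ℕ) (F : U → U → U → ℕ)
    (V V' V'' : J → U → U → ℕ) : U ⊕ J → U ⊕ J → U ⊕ J → ℕ
  | .inl p, .inl q, .inl r => F p q r + if p = q ∧ q = r then e else 0
  | .inl p, .inl q, .inr j => V j p q
  | .inl p, .inr j, .inl q => V' j p q
  | .inr j, .inl p, .inl q => V'' j p q
  | _, _, _ => 0

theorem exists_residual_splitting {U J : Type*} [Fintype U] [DecidableEq U] [Fintype J]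
    {e n : ℕ} {g : J → ℕ} {A : U → U → ℕ} (hA : ∀ p q, A p q ≤ if p = q then 0 else e)
    (hrow : ∀ p, ∑ q, A p q = n) (hcol : ∀ q, ∑ p, A p q = n)
    (hn : n + ∑ j, g j = e * (Fintype.card U - 1)) :
    ∃ V : J → U → U → ℕ, (∀ p q, A p q + (if p = q then e else 0) + ∑ j, V j p q = e) ∧
      (∀ j p, ∑ q, V j p q = g j) ∧ ∀ j q, ∑ p, V j p q = g j := by
  have hsum : ∀ p : U, ∑ q, (if p = q then 0 else e) = e * (Fintype.card U - 1) := by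
    intro p
    rw [← sum_erase_add _ _ (mem_univ p), if_pos rfl, add_zero,
      sum_congr rfl fun q hq => if_neg (ne_of_mem_erase hq).symm, sum_const,
      card_erase_of_mem (mem_univ p), card_univ, smul_eq_mul, mul_comm]
  obtain ⟨V, hV, hVr, hVc⟩ := exists_matrix_splitting
    (fun p q => (if p = q then 0 else e) - A p q) g (fun _ => 1) (fun _ => 1)
    (fun p => by
      rw [sum_tsub_distrib _ fun q _ => hA p q, hsum, hrow, mul_one]
      omega)
    (fun q => by
      rw [sum_tsub_distrib _ fun p _ => hA p q, hcol, mul_one]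
      simp only [eq_comm (b := q)]
      rw [hsum]
      omega)
  refine ⟨V, fun p q => ?_, by simpa using hVr, by simpa using hVc⟩
  rw [hV]
  have := hA p q
  split_ifs at this ⊢ <;> omega

theorem HasOutline.of_isPartialTensor {U J : Type*} [Fintype U] [DecidableEq U] [Fintype J]
    {a n : ℕ} {g : J → ℕ} {F : U → U → U → ℕ} (hF : IsPartialTensor (2 * a + 1) n F)
    (hn : n + ∑ j, g j = (2 * a + 1) * (Fintype.card U - 1))
    (hx : HasOutline (Sum.elim (fun _ : U => a) g)) :
    HasOutline (Sum.elim (fun _ : U => a + 1) g) := by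
  obtain ⟨x, ⟨h1, h2, h3⟩, hdiag⟩ := hx
  obtain ⟨f1, f2, f3, s1, s2, s3⟩ := hF
  obtain ⟨V, hV, hVr, hVc⟩ := exists_residual_splitting f1 s1 s2 hn
  obtain ⟨V', hV', hVr', hVc'⟩ := exists_residual_splitting f2
    (fun p => by rw [sum_comm, s1]) s3 hn
  obtain ⟨V'', hV'', hVr'', hVc''⟩ := exists_residual_splitting f3
    (fun p => by rw [sum_comm, s2]) (fun p => by rw [sum_comm, s3]) hn
  have hF0 : ∀ p, F p p p = 0 := by
    intro p
    have := f1 p p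
    rw [if_pos rfl, Nat.le_zero, sum_eq_zero_iff] at this
    exact this p (mem_univ p)
  refine ⟨fun i j l => x i j l + incrementArray (2 * a + 1) F V V' V'' i j l, ⟨?_, ?_, ?_⟩, ?_⟩
  · intro i j
    rw [sum_add_distrib, h1]
    rcases i with p | i <;> rcases j with q | j
    · have := hV p q
      have hite : ∑ r, (if p = q ∧ q = r then 2 * a + 1 else 0) =
          if p = q then 2 * a + 1 else 0 := by simp [ite_and]
      simp only [incrementArray, Fintype.sum_sum_type, sum_add_distrib, Sum.elim_inl, hite, this]
      ring
    · simp [incrementArray, hVr', add_mul]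
    · simp [incrementArray, hVr'', mul_add]
    · simp [incrementArray]
  · intro i j
    rw [sum_add_distrib, h2]
    rcases i with p | i <;> rcases j with q | j
    · have := hV' p q
      have hite : ∑ r, (if p = r ∧ r = q then 2 * a + 1 else 0) =
          if p = q then 2 * a + 1 else 0 := by simp [ite_and]
      simp only [incrementArray, Fintype.sum_sum_type, sum_add_distrib, Sum.elim_inl, hite, this]
      ring
    · simp [incrementArray, hVr, add_mul]
    · simp [incrementArray, hVc'', mul_add]
    · simp [incrementArray]
  · intro i j
    rw [sum_add_distrib, h3]
    rcases i with p | i <;> rcases j with q | j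
    · have := hV'' p q
      have hite : ∑ r, (if r = p ∧ p = q then 2 * a + 1 else 0) =
          if p = q then 2 * a + 1 else 0 := by simp [ite_and]
      simp only [incrementArray, Fintype.sum_sum_type, sum_add_distrib, Sum.elim_inl, hite, this]
      ring
    · simp [incrementArray, hVc, add_mul]
    · simp [incrementArray, hVc', mul_add]
    · simp [incrementArray]
  · rintro (p | j)
    · beta_reduce
      rw [hdiag]
      simp only [incrementArray, hF0, Sum.elim_inl, and_self, if_true]
      ring
    · beta_reduce
      rw [hdiag]
      simp [incrementArray]

theorem HasOutline.of_comp_equiv {ι κ : Type*} [Fintype ι] [Fintype κ] {h : κ → ℕ} (e : ι ≃ κ)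
    (hx : HasOutline (h ∘ e)) : HasOutline h := by
  obtain ⟨x, ⟨h1, h2, h3⟩, hdiag⟩ := hx
  refine ⟨fun i j l => x (e.symm i) (e.symm j) (e.symm l),
    ⟨fun i j => ?_, fun i j => ?_, fun i j => ?_⟩, fun i => ?_⟩
  · rw [e.symm.sum_comp (fun l => x (e.symm i) (e.symm j) l), h1]
    simp
  · rw [e.symm.sum_comp (fun l => x (e.symm i) l (e.symm j)), h2]
    simp
  · rw [e.symm.sum_comp (fun l => x l (e.symm i) (e.symm j)), h3]
    simp
  · simp [hdiag]

theorem hasOutline_sumElim_iff {u v a : ℕ} {h : ℕ → ℕ} (hu : ∀ i < u, h i = a) :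
    HasOutline (Sum.elim (fun _ : Fin u => a) fun j : Fin v => h (u + j)) ↔
      HasOutline fun i : Fin (u + v) => h i := by
  have hcomp : (fun i : Fin (u + v) => h i) ∘ finSumFinEquiv =
      Sum.elim (fun _ : Fin u => a) fun j : Fin v => h (u + j) := by
    funext i
    rcases i with i | j
    · simp [hu]
    · simp
  refine ⟨fun hx => .of_comp_equiv finSumFinEquiv (hcomp ▸ hx), fun hx => ?_⟩
  refine .of_comp_equiv finSumFinEquiv.symm ?_
  rwa [← hcomp, Function.comp_assoc, Equiv.self_comp_symm, Function.comp_id]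

theorem HasOutline.increment {u a : ℕ} {J : Type*} [Fintype J] {g : J → ℕ} (hu : 3 ≤ u)
    (hu' : u ≤ 6) (hg : ∑ j, g j ≤ (2 * a + 1) * (u - 1))
    (hx : HasOutline (Sum.elim (fun _ : Fin u => a) g)) :
    HasOutline (Sum.elim (fun _ : Fin u => a + 1) g) := by
  obtain ⟨F, hF⟩ := exists_isPartialTensor hu hu' (Nat.sub_le _ (∑ j, g j))
  exact hx.of_isPartialTensor hF (by rw [Fintype.card_fin, Nat.sub_add_cancel hg])

theorem hasOutline_of_antitone {a k : ℕ} {h : ℕ → ℕ} (hk : 3 ≤ k)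
    (hanti : ∀ i j, i ≤ j → j < k → h j ≤ h i) (h0 : h 0 = a) (h2 : h 2 = a) :
    HasOutline fun i : Fin k => h i := by
  induction a generalizing h with
  | zero =>
    have hz : ∀ i : Fin k, h i = 0 := fun i => by
      have := hanti 0 i (Nat.zero_le _) i.2
      omega
    exact ⟨fun _ _ _ => 0, by simp [IsOutline, hz], by simp [hz]⟩
  | succ a ih =>
    obtain ⟨v, rfl⟩ := Nat.exists_eq_add_of_le hk
    obtain ⟨u, huk, hu⟩ := exists_threshold hanti a
    have hu3 : 3 ≤ u := by
      have := hu 2 (by omega)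
      omega
    have htop : ∀ i < u, h i = a + 1 := by
      intro i hi
      have h1 := hu i (by omega)
      have h3 := hanti 0 i (Nat.zero_le _) (by omega)
      omega
    by_cases hlarge : 0 < h 3 ∧ 3 * (a + 1) + h 3 ≤ ∑ i ∈ range v, h (3 + i)
    · refine (hasOutline_sumElim_iff fun i hi => htop i (by omega)).1 ?_
      have hv : 0 < v := by
        rcases v.eq_zero_or_pos with rfl | hv
        · simp only [range_zero, sum_empty] at hlarge
          omega
        · exact hv
      refine hasOutline_of_le_sum (g := fun i => h (3 + i))
        (fun i j hij hj => hanti _ _ (by omega) (by omega)) hlarge.1 ?_ hlarge.2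
      have := hanti 0 3 (by omega) (by omega)
      simp only [add_zero]
      omega
    · obtain ⟨w, hw⟩ := Nat.exists_eq_add_of_le huk
      obtain ⟨c, rfl⟩ := Nat.exists_eq_add_of_le hu3
      obtain rfl : v = c + w := by omega
      have hsum : ∑ i ∈ range (c + w), h (3 + i) =
          c * (a + 1) + ∑ j ∈ range w, h (3 + c + j) := by
        rw [sum_range_add, sum_congr rfl fun i hi => htop (3 + i) (by simpa using hi), sum_const,
          card_range, smul_eq_mul]
        simp only [add_assoc]
      have hsmall : ∑ i ∈ range (c + w), h (3 + i) < 3 * (a + 1) +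
          if c = 0 then a else a + 1 := by
        rcases (c + w).eq_zero_or_pos with hcw | hcw
        · rw [hcw, sum_range_zero]
          omega
        · have h3 : h 3 ≤ if c = 0 then a else a + 1 := by
            split_ifs with hc
            · exact (hu 3 (by omega)).2 (by omega)
            · exact (htop 3 (by omega)).le
          rcases (h 3).eq_zero_or_pos with hz | hz
          · rw [sum_eq_zero fun i hi => Nat.le_zero.1 <| hz ▸ hanti 3 (3 + i) (by omega)
              (by rw [mem_range] at hi; omega)]
            omega
          · omega
      rw [hsum] at hsmall
      have hc : c < 4 := by
        refine Nat.lt_of_mul_lt_mul_right (a := a + 1) ?_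
        split_ifs at hsmall <;> omega
      rw [hw]
      refine (hasOutline_sumElim_iff htop).1 (.increment hu3 (by omega) ?_ ?_)
      · rw [Fin.sum_univ_eq_sum_range (fun j => h (3 + c + j))]
        interval_cases c <;> simp at hsmall ⊢ <;> omega
      · have hext : (fun j : Fin w => h (3 + c + j)) =
            fun j : Fin w => (fun i => if i < 3 + c then a else h i) (3 + c + j) := by
          funext j
          simp
        rw [hext, hasOutline_sumElim_iff (h := fun i => if i < 3 + c then a else h i)
          (by simp +contextual), ← hw]
        refine ih (h := fun i => if i < 3 + c then a else h i) (fun i j hij hj => ?_)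
          (if_pos (by omega)) (if_pos (by omega))
        have h1 := hanti i j hij hj
        have h3 := hu j hj
        split_ifs <;> omega

end Outlines

/-- if `k ≥ 3` and `h_1 = h_2 = h_3 ≥ h_4 ≥ … ≥ h_k > 0`, then
there exists a realization `LS(h_1 h_2 h_3 h_4 … h_k)`. (1-based indexing.) -/
theorem statement1 (k : ℕ) (h : ℕ → ℕ) (hk : 3 ≤ k)
    (hpos : ∀ i, 1 ≤ i → i ≤ k → 0 < h i)
    (h12 : h 1 = h 2) (h23 : h 2 = h 3)
    (hmono : ∀ i, 3 ≤ i → i < k → h (i + 1) ≤ h i) :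
    HasRealization (fun i : Fin k => h ((i : ℕ) + 1)) := by
  refine HasOutline.hasRealization (?_ : HasOutline fun i : Fin k => h ((i : ℕ) + 1))
  refine hasOutline_of_antitone (h := fun i => h (i + 1)) hk (fun i j hij => ?_) rfl
    (h12.trans h23).symm
  induction j, hij using Nat.le_induction with
  | base => exact fun _ => le_rfl
  | succ j hij ih =>
    refine fun hj => le_trans ?_ (ih (by omega))
    rcases Nat.lt_or_ge j 2 with hj2 | hj2
    · interval_cases j
      · exact h12.ge
      · exact h23.ge
    · exact hmono (j + 1) (by omega) hj
end

section
/- Let h_1 ≥ h_2 ≥ … ≥ h_k > 0 be integers and let n be an integer with n ≥ 2h_1 + (h_1 + h_2 + … + h_k). Then there exists an incomplete latin square ILS(n; h_1 h_2 … h_k). -/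
/-- Distinct members of the edge set `A` differ in both coordinates. -/
def IsMatchingSet {R C : Type*} (A : Finset (R × C)) : Prop :=
  ∀ a ∈ A, ∀ b ∈ A, a.1 = b.1 ∨ a.2 = b.2 → a = b

theorem IsMatchingSet.subset {R C : Type*} {A B : Finset (R × C)} (hB : IsMatchingSet B)
    (h : A ⊆ B) : IsMatchingSet A :=
  fun a ha b hb hab => hB a (h ha) b (h hb) hab

theorem IsMatchingSet.insert_edge {R C : Type*} [DecidableEq R] [DecidableEq C]
    {A : Finset (R × C)} (hA : IsMatchingSet A) {e : R × C}
    (h1 : ∀ a ∈ A, a.1 ≠ e.1) (h2 : ∀ a ∈ A, a.2 ≠ e.2) : IsMatchingSet (insert e A) := by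
  intro a ha b hb hab
  rw [Finset.mem_insert] at ha hb
  rcases ha with rfl | ha <;> rcases hb with rfl | hb
  · rfl
  · rcases hab with hab | hab
    · exact absurd hab.symm (h1 b hb)
    · exact absurd hab.symm (h2 b hb)
  · rcases hab with hab | hab
    · exact absurd hab (h1 a ha)
    · exact absurd hab (h2 a ha)
  · exact hA a ha b hb hab

theorem IsMatchingSet.exists_exchange {R C : Type*} [DecidableEq R] [DecidableEq C]
    {A B : Finset (R × C)} (hA : IsMatchingSet A) (hB : IsMatchingSet B) (hAB : Disjoint A B)
    (hlt : B.card < A.card) :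
    ∃ A' B' : Finset (R × C), IsMatchingSet A' ∧ IsMatchingSet B' ∧ Disjoint A' B' ∧
      A' ∪ B' = A ∪ B ∧ A'.card + 1 = A.card ∧ B'.card = B.card + 1 ∧
      (∀ a ∈ A', ∃ a' ∈ A, a'.1 = a.1) ∧ (∀ a ∈ A', ∃ a' ∈ A, a'.2 = a.2) := by
  induction hN : A.card generalizing A B with
  | zero => omega
  | succ N ih =>
    obtain ⟨r0, hr0A, hr0B⟩ : ∃ r ∈ A.image Prod.fst, r ∉ B.image Prod.fst := by
      apply Finset.exists_mem_notMem_of_card_lt_card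
      rw [Finset.card_image_of_injOn (fun a ha b hb hab => hA a ha b hb (Or.inl hab))]
      exact lt_of_le_of_lt Finset.card_image_le hlt
    obtain ⟨⟨_, c0⟩, he0, rfl⟩ := Finset.mem_image.1 hr0A
    simp only [Finset.mem_image, not_exists, not_and] at hr0B
    by_cases hc : ∃ r1, (r1, c0) ∈ B
    · obtain ⟨r1, he1⟩ := hc
      rename_i r0
      have hsubA : A.erase (r0, c0) ⊆ A := Finset.erase_subset _ _
      have hsubB : B.erase (r1, c0) ⊆ B := Finset.erase_subset _ _
      have hcA := Finset.card_erase_add_one he0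
      have hcB := Finset.card_erase_add_one he1
      obtain ⟨A1, B1, hA1, hB1, hd, hu, hc1, hc2, hr, hcl⟩ :=
        ih (hA.subset hsubA) (hB.subset hsubB) (hAB.mono hsubA hsubB) (by omega) (by omega)
      have hne : r1 ≠ r0 := fun h => hr0B _ he1 h
      have hmem : ∀ e, e ∈ A1 ∨ e ∈ B1 ↔ (e ≠ (r0, c0) ∧ e ∈ A) ∨ (e ≠ (r1, c0) ∧ e ∈ B) := by
        intro e
        have := congrArg (e ∈ ·) hu
        simpa using this
      have hrow0 : ∀ e, e ∈ A1 ∨ e ∈ B1 → e.1 ≠ r0 := by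
        intro e he h
        rcases (hmem e).1 he with ⟨h1, h2⟩ | ⟨h1, h2⟩
        · exact h1 (hA _ h2 _ he0 (Or.inl h))
        · exact hr0B _ h2 h
      have hcol0 : ∀ e, e ∈ A1 ∨ e ∈ B1 → e.2 ≠ c0 := by
        intro e he h
        rcases (hmem e).1 he with ⟨h1, h2⟩ | ⟨h1, h2⟩
        · exact h1 (hA _ h2 _ he0 (Or.inr h))
        · exact h1 (hB _ h2 _ he1 (Or.inr h))
      have hdis : ∀ e, e ∈ A1 → e ∈ B1 → False := fun e h1 h2 =>
        (Finset.disjoint_left.1 hd) h1 h2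
      have hn0 : (r0, c0) ∉ A1 ∧ (r0, c0) ∉ B1 :=
        ⟨fun h => hrow0 _ (Or.inl h) rfl, fun h => hrow0 _ (Or.inr h) rfl⟩
      have hn1 : (r1, c0) ∉ A1 ∧ (r1, c0) ∉ B1 :=
        ⟨fun h => hcol0 _ (Or.inl h) rfl, fun h => hcol0 _ (Or.inr h) rfl⟩
      by_cases hrB : ∃ e ∈ B1, e.1 = r1
      · obtain ⟨e, heB, he1'⟩ := hrB
        have heA : e ∈ A := by
          rcases (hmem e).1 (Or.inr heB) with ⟨h1, h2⟩ | ⟨h1, h2⟩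
          · exact h2
          · exact absurd (hB _ h2 _ he1 (Or.inl he1')) h1
        have hrA : ∀ a ∈ A1, a.1 ≠ r1 := by
          intro a ha har
          rcases (hmem a).1 (Or.inl ha) with ⟨h1, h2⟩ | ⟨h1, h2⟩
          · exact hdis a ha ((hA _ h2 _ heA (Or.inl (har.trans he1'.symm))) ▸ heB)
          · exact h1 (hB _ h2 _ he1 (Or.inl har))
        refine ⟨insert (r1, c0) A1, insert (r0, c0) B1, hA1.insert_edge hrA
          (fun a ha => hcol0 a (Or.inl ha)), hB1.insert_edge (fun a ha => hrow0 a (Or.inr ha))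
          (fun a ha => hcol0 a (Or.inr ha)), ?_, ?_, ?_, ?_, ?_, ?_⟩
        · rw [Finset.disjoint_left]
          grind
        · ext x
          have := hmem x
          grind
        · rw [Finset.card_insert_of_notMem hn1.1]; omega
        · rw [Finset.card_insert_of_notMem hn0.2]; omega
        · grind
        · grind
      · refine ⟨insert (r0, c0) A1, insert (r1, c0) B1,
          hA1.insert_edge (fun a ha => hrow0 a (Or.inl ha)) (fun a ha => hcol0 a (Or.inl ha)),
          hB1.insert_edge (fun a ha h => hrB ⟨a, ha, h⟩)
          (fun a ha => hcol0 a (Or.inr ha)), ?_, ?_, ?_, ?_, ?_, ?_⟩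
        · rw [Finset.disjoint_left]
          grind
        · ext x
          have := hmem x
          grind
        · rw [Finset.card_insert_of_notMem hn0.1]; omega
        · rw [Finset.card_insert_of_notMem hn1.2]; omega
        · grind
        · grind
    · rename_i r0
      have hnB : (r0, c0) ∉ B := fun h => hc ⟨_, h⟩
      refine ⟨A.erase (r0, c0), insert (r0, c0) B, hA.subset (Finset.erase_subset _ _),
        hB.insert_edge hr0B (fun a ha h => hc ⟨a.1, by rwa [← show a.2 = c0 from h]⟩),
        ?_, ?_, ?_, ?_, ?_, ?_⟩
      · rw [Finset.disjoint_left] at hAB ⊢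
        grind
      · grind
      · rw [Finset.card_erase_add_one he0, hN]
      · rw [Finset.card_insert_of_notMem hnB]
      · grind
      · grind

/-- No symbol is repeated in a row or a column of `A`. -/
def IsProperArray {X Y Z : Type*} (A : X → Y → Z) : Prop :=
  (∀ i, Function.Injective (A i)) ∧ ∀ j, Function.Injective fun i => A i j

/-- The number of occurrences of the symbol `z` in the array `A`. -/
def occ {X Y Z : Type*} [Fintype X] [Fintype Y] [DecidableEq Z] (A : X → Y → Z) (z : Z) : ℕ :=
  (Finset.univ.filter fun p : X × Y => A p.1 p.2 = z).card

theorem IsProperArray.exists_flip {X Y Z : Type*} [Fintype X] [Fintype Y] [DecidableEq X]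
    [DecidableEq Y] [DecidableEq Z] {A : X → Y → Z} (hA : IsProperArray A)
    (D : Finset (X × Y)) {s w : Z} (hsw : s ≠ w) (hw : ∀ p ∈ D, A p.1 p.2 ≠ w)
    (hlt : occ A w + (D.filter fun p => A p.1 p.2 = s).card < occ A s) :
    ∃ A' : X → Y → Z, IsProperArray A' ∧ (∀ p ∈ D, A' p.1 p.2 = A p.1 p.2) ∧
      occ A' s + 1 = occ A s ∧ occ A' w = occ A w + 1 ∧
      ∀ z, z ≠ s → z ≠ w → occ A' z = occ A z := by
  have hmatch : ∀ z, IsMatchingSet ((Finset.univ \ D).filter fun p : X × Y => A p.1 p.2 = z) := by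
    rintro z ⟨a, b⟩ ha ⟨a', b'⟩ hb hab
    simp only [Finset.mem_filter] at ha hb
    rcases hab with hab | hab
    · obtain rfl : a = a' := hab
      rw [hA.1 a (ha.2.trans hb.2.symm)]
    · obtain rfl : b = b' := hab
      have := hA.2 b (a₁ := a) (a₂ := a') (ha.2.trans hb.2.symm)
      rw [this]
  have hdisj : Disjoint ((Finset.univ \ D).filter fun p : X × Y => A p.1 p.2 = s)
      ((Finset.univ \ D).filter fun p : X × Y => A p.1 p.2 = w) := by
    rw [Finset.disjoint_left]
    intro p hp hp'
    exact hsw ((Finset.mem_filter.1 hp).2.symm.trans (Finset.mem_filter.1 hp').2)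
  have hcount : ∀ (F : X → Y → Z) z, occ F z =
      ((Finset.univ \ D).filter fun p : X × Y => F p.1 p.2 = z).card +
        (D.filter fun p => F p.1 p.2 = z).card := by
    intro F z
    rw [occ, ← Finset.card_union_of_disjoint, ← Finset.filter_union]
    · congr 2
      simp
    · exact Finset.disjoint_filter_filter Finset.sdiff_disjoint
  have hw0 : (D.filter fun p => A p.1 p.2 = w).card = 0 := by
    rw [Finset.card_eq_zero, Finset.filter_eq_empty_iff]
    exact fun p hp => hw p hp
  obtain ⟨S', W', hS', hW', hd, hu, hcS, hcW, hrow, hcol⟩ :=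
    (hmatch s).exists_exchange (hmatch w) hdisj (by
      have h1 := hcount A s
      have h2 := hcount A w
      omega)
  have hmem : ∀ p : X × Y, p ∈ S' ∨ p ∈ W' ↔ p ∉ D ∧ (A p.1 p.2 = s ∨ A p.1 p.2 = w) := by
    intro p
    have := congrArg (p ∈ ·) hu
    simp only [Finset.mem_union, Finset.mem_filter, Finset.mem_sdiff, Finset.mem_univ, true_and,
      eq_iff_iff] at this
    rw [this]
    tauto
  have hdis : ∀ e, e ∈ S' → e ∈ W' → False := fun e h1 h2 => (Finset.disjoint_left.1 hd) h1 h2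
  set A' : X → Y → Z := fun x y => if (x, y) ∈ S' then s else if (x, y) ∈ W' then w else A x y
    with hA'
  have hval : ∀ x y, ((x, y) ∈ S' ∧ A' x y = s) ∨ ((x, y) ∈ W' ∧ A' x y = w) ∨
      ((x, y) ∉ S' ∧ (x, y) ∉ W' ∧ A' x y = A x y) := by
    intro x y
    simp only [hA']
    by_cases h1 : (x, y) ∈ S'
    · simp [h1]
    · by_cases h2 : (x, y) ∈ W' <;> simp [h1, h2]
  have hfix : ∀ p ∈ D, A' p.1 p.2 = A p.1 p.2 := by
    rintro ⟨x, y⟩ hp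
    have := hmem (x, y)
    rcases hval x y with h | h | h
    · exact absurd hp (this.1 (Or.inl h.1)).1
    · exact absurd hp (this.1 (Or.inr h.1)).1
    · exact h.2.2
  have hD : ∀ z, (D.filter fun p => A' p.1 p.2 = z) = D.filter fun p => A p.1 p.2 = z := by
    intro z
    apply Finset.filter_congr
    intro p hp
    rw [hfix p hp]
  have hout : ∀ p : X × Y, p ∉ S' → p ∉ W' → A p.1 p.2 = s ∨ A p.1 p.2 = w → p ∈ D := by
    intro p h1 h2 h3
    by_contra h4
    rcases (hmem p).2 ⟨h4, h3⟩ with h | h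
    · exact h1 h
    · exact h2 h
  have hSset : ((Finset.univ \ D).filter fun p : X × Y => A' p.1 p.2 = s) = S' := by
    ext ⟨x, y⟩
    have h1 := hmem (x, y)
    have h2 := hout (x, y)
    have h3 := hdis (x, y)
    simp only [Finset.mem_filter, Finset.mem_sdiff, Finset.mem_univ, true_and]
    rcases hval x y with h | h | h <;> grind
  have hWset : ((Finset.univ \ D).filter fun p : X × Y => A' p.1 p.2 = w) = W' := by
    ext ⟨x, y⟩
    have h1 := hmem (x, y)
    have h2 := hout (x, y)
    have h3 := hdis (x, y)
    simp only [Finset.mem_filter, Finset.mem_sdiff, Finset.mem_univ, true_and]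
    rcases hval x y with h | h | h <;> grind
  refine ⟨A', ⟨?_, ?_⟩, hfix, ?_, ?_, ?_⟩
  · intro x y y' hyy
    have key : ∀ y y', (x, y) ∈ S' → (x, y') ∉ S' → (x, y') ∉ W' → A x y' ≠ s := by
      intro y y' h1 h2 h3 h4
      obtain ⟨⟨x0, y0⟩, ha, hx⟩ := hrow _ h1
      obtain rfl : x0 = x := hx
      simp only [Finset.mem_filter, Finset.mem_sdiff, Finset.mem_univ, true_and] at ha
      have : y0 = y' := hA.1 x0 (ha.2.trans h4.symm)
      subst this
      exact ha.1 (hout (x0, y0) h2 h3 (Or.inl ha.2))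
    have key' : ∀ y', (x, y') ∉ S' → (x, y') ∉ W' → A x y' ≠ w := by
      intro y' h2 h3 h4
      exact hw _ (hout (x, y') h2 h3 (Or.inr h4)) h4
    rcases hval x y with h | h | h <;> rcases hval x y' with h' | h' | h'
    · exact (Prod.ext_iff.1 (hS' _ h.1 _ h'.1 (Or.inl rfl))).2
    · exact absurd (h.2.symm.trans (hyy.trans h'.2)) hsw
    · exact absurd (h'.2.2.symm.trans (hyy.symm.trans h.2)) (key y y' h.1 h'.1 h'.2.1)
    · exact absurd (h'.2.symm.trans (hyy.symm.trans h.2)) hsw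
    · exact (Prod.ext_iff.1 (hW' _ h.1 _ h'.1 (Or.inl rfl))).2
    · exact absurd (h'.2.2.symm.trans (hyy.symm.trans h.2)) (key' y' h'.1 h'.2.1)
    · exact absurd (h.2.2.symm.trans (hyy.trans h'.2)) (key y' y h'.1 h.1 h.2.1)
    · exact absurd (h.2.2.symm.trans (hyy.trans h'.2)) (key' y h.1 h.2.1)
    · exact hA.1 x (h.2.2.symm.trans (hyy.trans h'.2.2))
  · intro y x x' hxx
    have key : ∀ x x', (x, y) ∈ S' → (x', y) ∉ S' → (x', y) ∉ W' → A x' y ≠ s := by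
      intro x x' h1 h2 h3 h4
      obtain ⟨⟨x0, y0⟩, ha, hx⟩ := hcol _ h1
      obtain rfl : y0 = y := hx
      simp only [Finset.mem_filter, Finset.mem_sdiff, Finset.mem_univ, true_and] at ha
      have : x0 = x' := hA.2 y0 (ha.2.trans h4.symm)
      subst this
      exact ha.1 (hout (x0, y0) h2 h3 (Or.inl ha.2))
    have key' : ∀ x', (x', y) ∉ S' → (x', y) ∉ W' → A x' y ≠ w := by
      intro x' h2 h3 h4
      exact hw _ (hout (x', y) h2 h3 (Or.inr h4)) h4
    replace hxx : A' x y = A' x' y := hxx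
    rcases hval x y with h | h | h <;> rcases hval x' y with h' | h' | h'
    · exact (Prod.ext_iff.1 (hS' _ h.1 _ h'.1 (Or.inr rfl))).1
    · exact absurd (h.2.symm.trans (hxx.trans h'.2)) hsw
    · exact absurd (h'.2.2.symm.trans (hxx.symm.trans h.2)) (key x x' h.1 h'.1 h'.2.1)
    · exact absurd (h'.2.symm.trans (hxx.symm.trans h.2)) hsw
    · exact (Prod.ext_iff.1 (hW' _ h.1 _ h'.1 (Or.inr rfl))).1
    · exact absurd (h'.2.2.symm.trans (hxx.symm.trans h.2)) (key' x' h'.1 h'.2.1)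
    · exact absurd (h.2.2.symm.trans (hxx.trans h'.2)) (key x' x h'.1 h.1 h.2.1)
    · exact absurd (h.2.2.symm.trans (hxx.trans h'.2)) (key' x h.1 h.2.1)
    · exact hA.2 y (h.2.2.symm.trans (hxx.trans h'.2.2))
  · rw [hcount A', hcount A, hD, hSset]
    omega
  · rw [hcount A', hcount A, hD, hWset]
    omega
  · intro z hzs hzw
    rw [occ, occ]
    congr 1
    apply Finset.filter_congr
    rintro ⟨x, y⟩ -
    have h1 := hmem (x, y)
    rcases hval x y with h | h | h <;> grind

theorem Finset.sum_eq_sum_add_one {Z : Type*} [DecidableEq Z] {W : Finset Z} {f g : Z → ℕ}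
    {w : Z} (hw : w ∈ W) (h : f w = g w + 1) (hne : ∀ z ∈ W, z ≠ w → f z = g z) :
    ∑ z ∈ W, f z = ∑ z ∈ W, g z + 1 := by
  rw [← Finset.add_sum_erase W f hw, ← Finset.add_sum_erase W g hw, h,
    Finset.sum_congr rfl fun z hz => hne z (Finset.mem_of_mem_erase hz) (Finset.ne_of_mem_erase hz)]
  exact add_right_comm _ _ _

theorem sum_occ {X Y Z : Type*} [Fintype X] [Fintype Y] [Fintype Z] [DecidableEq Z]
    (A : X → Y → Z) : ∑ z, occ A z = Fintype.card X * Fintype.card Y := by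
  have := Finset.card_eq_sum_card_fiberwise (f := fun p : X × Y => A p.1 p.2)
    (s := Finset.univ) (t := Finset.univ) (fun _ _ => Finset.mem_coe.2 (Finset.mem_univ _))
  rw [Finset.card_univ, Fintype.card_prod] at this
  exact this.symm

theorem IsProperArray.exists_balanced {X Y Z : Type*} [Fintype X] [Fintype Y] [Fintype Z]
    [DecidableEq X] [DecidableEq Y] [DecidableEq Z] {A : X → Y → Z} (hA : IsProperArray A)
    (D : Finset (X × Y)) (Q W : Finset Z) (T H : ℕ) (hQW : Disjoint Q W)
    (hQ : ∀ p ∈ D, A p.1 p.2 ∉ Q) (hW : ∀ p ∈ D, A p.1 p.2 ∉ W)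
    (hT : ∀ z ∉ W, T ≤ occ A z) (hH : ∀ z, (D.filter fun p => A p.1 p.2 = z).card ≤ H)
    (hcard : Fintype.card Z * T ≤ Fintype.card X * Fintype.card Y)
    (hsum : ∑ w ∈ W, (T - occ A w) ≤ ∑ q ∈ Q, (occ A q - T) ∨
      W.card * H ≤ ∑ q ∈ Q, (occ A q - T)) :
    ∃ A' : X → Y → Z, IsProperArray A' ∧ (∀ p ∈ D, A' p.1 p.2 = A p.1 p.2) ∧
      ∀ z, T ≤ occ A' z := by
  induction hd : ∑ w ∈ W, (T - occ A w) generalizing A with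
  | zero =>
    refine ⟨A, hA, fun _ _ => rfl, fun z => ?_⟩
    by_cases hz : z ∈ W
    · have := Finset.sum_eq_zero_iff.1 hd z hz
      omega
    · exact hT z hz
  | succ d ih =>
    have hQnW : ∀ q ∈ Q, q ∉ W := fun q hq => Finset.disjoint_left.1 hQW hq
    have step : ∀ s w, w ∈ W → occ A w < T → T < occ A s →
        occ A w + (D.filter fun p => A p.1 p.2 = s).card < occ A s →
        (∀ A' : X → Y → Z, occ A' s + 1 = occ A s →
          (∀ z, z ≠ s → z ≠ w → occ A' z = occ A z) →
          d ≤ ∑ q ∈ Q, (occ A' q - T) ∨ W.card * H ≤ ∑ q ∈ Q, (occ A' q - T)) →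
        ∃ A' : X → Y → Z, IsProperArray A' ∧ (∀ p ∈ D, A' p.1 p.2 = A p.1 p.2) ∧
          ∀ z, T ≤ occ A' z := by
      intro s w hw hwT hsT hlt hQ'
      have hsw : s ≠ w := by
        rintro rfl
        omega
      obtain ⟨A', hA', hfix, h1, h2, h3⟩ := hA.exists_flip D hsw
        (fun p hp h => hW p hp (h ▸ hw)) hlt
      have hsum' : ∑ w ∈ W, (T - occ A' w) = d := by
        have : ∑ w ∈ W, (T - occ A w) = ∑ w ∈ W, (T - occ A' w) + 1 := by
          apply Finset.sum_eq_sum_add_one hw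
          · omega
          · intro z _ hzw
            by_cases hzs : z = s
            · subst hzs
              omega
            · rw [h3 z hzs hzw]
        omega
      obtain ⟨A'', hA'', hfix', hT'⟩ := ih hA' (fun p hp => hfix p hp ▸ hQ p hp)
        (fun p hp => hfix p hp ▸ hW p hp)
        (fun z hz => by
          by_cases hzs : z = s
          · subst hzs
            omega
          · rw [h3 z hzs (fun h => hz (h ▸ hw))]
            exact hT z hz)
        (fun z => by
          rw [Finset.filter_congr (fun p hp => by rw [hfix p hp])]
          exact hH z)
        (by rw [hsum']; exact hQ' A' h1 h3) hsum'
      exact ⟨A'', hA'', fun p hp => (hfix' p hp).trans (hfix p hp), hT'⟩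
    by_cases hcase : ∑ w ∈ W, (T - occ A w) ≤ ∑ q ∈ Q, (occ A q - T)
    · obtain ⟨w, hw, hwT⟩ : ∃ w ∈ W, T - occ A w ≠ 0 :=
        Finset.exists_ne_zero_of_sum_ne_zero (by omega)
      obtain ⟨q, hq, hqT⟩ : ∃ q ∈ Q, occ A q - T ≠ 0 :=
        Finset.exists_ne_zero_of_sum_ne_zero (by omega)
      have h0 : (D.filter fun p => A p.1 p.2 = q).card = 0 := by
        rw [Finset.card_eq_zero, Finset.filter_eq_empty_iff]
        exact fun p hp h => hQ p hp (h ▸ hq)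
      refine step q w hw (by omega) (by omega) (by omega) (fun A' h1 h3 => Or.inl ?_)
      have : ∑ q ∈ Q, (occ A q - T) = ∑ q ∈ Q, (occ A' q - T) + 1 := by
        apply Finset.sum_eq_sum_add_one hq
        · omega
        · intro z hz hzq
          rw [h3 z hzq (fun h => hQnW z hz (h ▸ hw))]
      omega
    · have hWH := hsum.resolve_left hcase
      push Not at hcase
      obtain ⟨w, hw, hwT⟩ : ∃ w ∈ W, H < T - occ A w := by
        by_contra! hcon
        have := Finset.sum_le_card_nsmul W _ H hcon
        rw [smul_eq_mul] at this
        omega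
      obtain ⟨s, hs, hsT⟩ : ∃ s, s ∉ Q ∧ T < occ A s := by
        by_contra! hcon
        have h1 : ∑ z ∈ Q, occ A z + ∑ z ∈ Qᶜ, occ A z = Fintype.card X * Fintype.card Y := by
          rw [Finset.sum_add_sum_compl, sum_occ]
        have h2 : ∑ z ∈ Q, occ A z = ∑ z ∈ Q, (occ A z - T) + Q.card * T := by
          rw [← smul_eq_mul, ← Finset.sum_const, ← Finset.sum_add_distrib]
          refine Finset.sum_congr rfl fun z hz => ?_
          have := hT z (hQnW z hz)
          omega
        have h3 : ∑ z ∈ Qᶜ, occ A z + ∑ z ∈ Qᶜ, (T - occ A z) = Qᶜ.card * T := by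
          rw [← smul_eq_mul, ← Finset.sum_const, ← Finset.sum_add_distrib]
          refine Finset.sum_congr rfl fun z hz => ?_
          have := hcon z (Finset.mem_compl.1 hz)
          omega
        have h4 : ∑ z ∈ W, (T - occ A z) ≤ ∑ z ∈ Qᶜ, (T - occ A z) :=
          Finset.sum_le_sum_of_subset fun z hz =>
            Finset.mem_compl.2 fun hzQ => hQnW z hzQ hz
        have h5 : Q.card * T + Qᶜ.card * T = Fintype.card Z * T := by
          rw [← add_mul, Finset.card_add_card_compl]
        omega
      have hsH := hH s
      refine step s w hw (by omega) hsT (by omega) (fun A' h1 h3 => Or.inr ?_)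
      rw [Finset.sum_congr rfl fun q hq => by
        rw [h3 q (fun h => hs (h ▸ hq)) (fun h => hQnW q hq (h ▸ hw))]]
      exact hWH

theorem exists_bijective_of_regular {U V : Type*} [Fintype U] [Fintype V] [DecidableEq V]
    {m : ℕ} (hm : 0 < m) (M : U → V → ℕ) (hrow : ∀ i, ∑ j, M i j = m)
    (hcol : ∀ j, ∑ i, M i j = m) : ∃ f : U → V, Function.Bijective f ∧ ∀ i, 0 < M i (f i) := by
  have hall : ∀ s : Finset U,
      s.card ≤ (s.biUnion fun i => Finset.univ.filter fun j => 0 < M i j).card := by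
    intro s
    set N := s.biUnion fun i => Finset.univ.filter fun j => 0 < M i j with hN
    have h1 : ∑ i ∈ s, ∑ j, M i j = ∑ i ∈ s, ∑ j ∈ N, M i j := by
      refine Finset.sum_congr rfl fun i hi => ?_
      symm
      apply Finset.sum_subset (Finset.subset_univ _)
      intro j _ hj
      by_contra hne
      exact hj (Finset.mem_biUnion.2 ⟨i, hi, Finset.mem_filter.2
        ⟨Finset.mem_univ _, Nat.pos_of_ne_zero hne⟩⟩)
    have h2 : ∑ j ∈ N, ∑ i ∈ s, M i j ≤ ∑ j ∈ N, ∑ i, M i j :=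
      Finset.sum_le_sum fun j _ => Finset.sum_le_sum_of_subset (Finset.subset_univ _)
    rw [Finset.sum_comm, ← h1] at h2
    simp only [hrow, hcol, Finset.sum_const, smul_eq_mul] at h2
    exact Nat.le_of_mul_le_mul_right h2 hm
  obtain ⟨f, hf, hfm⟩ := (Finset.all_card_le_biUnion_card_iff_exists_injective _).1 hall
  refine ⟨f, ?_, fun i => (Finset.mem_filter.1 (hfm i)).2⟩
  rw [Fintype.bijective_iff_injective_and_card]
  refine ⟨hf, ?_⟩
  have h3 : ∑ i, ∑ j, M i j = ∑ j, ∑ i, M i j := Finset.sum_comm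
  simp only [hrow, hcol, Finset.sum_const, smul_eq_mul, Finset.card_univ] at h3
  exact Nat.eq_of_mul_eq_mul_right hm h3

theorem exists_decomposition_of_regular {U V : Type*} [Fintype U] [Fintype V] [DecidableEq V]
    (m : ℕ) (M : U → V → ℕ) (hrow : ∀ i, ∑ j, M i j = m) (hcol : ∀ j, ∑ i, M i j = m) :
    ∃ σ : Fin m → U → V, (∀ c, Function.Injective (σ c)) ∧
      ∀ i j, (Finset.univ.filter fun c => σ c i = j).card = M i j := by
  classical
  induction m generalizing M with
  | zero =>
    refine ⟨fun c => c.elim0, fun c => c.elim0, fun i j => ?_⟩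
    have := Finset.sum_eq_zero_iff.1 (hrow i) j (Finset.mem_univ _)
    simp [this]
  | succ m ih =>
    obtain ⟨f, hf, hpos⟩ := exists_bijective_of_regular (Nat.succ_pos m) M hrow hcol
    have hle : ∀ i j, (if f i = j then 1 else 0) ≤ M i j := by
      intro i j
      split_ifs with h
      · exact h ▸ hpos i
      · exact Nat.zero_le _
    have hsub : ∀ i j, M i j - (if f i = j then 1 else 0) + (if f i = j then 1 else 0) = M i j :=
      fun i j => Nat.sub_add_cancel (hle i j)
    obtain ⟨σ, hσ, hcount⟩ := ih (fun i j => M i j - if f i = j then 1 else 0)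
      (fun i => by
        have h1 : ∑ j, (M i j - if f i = j then 1 else 0) + ∑ j, (if f i = j then 1 else 0)
            = m + 1 := by
          rw [← Finset.sum_add_distrib, Finset.sum_congr rfl fun j _ => hsub i j, hrow]
        rw [Finset.sum_ite_eq] at h1
        simpa using h1)
      (fun j => by
        obtain ⟨i0, rfl⟩ := hf.2 j
        have h1 : ∑ i, (M i (f i0) - if f i = f i0 then 1 else 0)
            + ∑ i, (if f i = f i0 then 1 else 0) = m + 1 := by
          rw [← Finset.sum_add_distrib, Finset.sum_congr rfl fun i _ => hsub i (f i0), hcol]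
        simp only [hf.1.eq_iff, Finset.sum_ite_eq', Finset.mem_univ, if_true] at h1 ⊢
        omega)
    refine ⟨Fin.cons f σ, fun c => ?_, fun i j => ?_⟩
    · refine Fin.cases ?_ (fun c => ?_) c
      · simpa using hf.1
      · simpa using hσ c
    · have h1 := hcount i j
      have h2 := hsub i j
      rw [Finset.card_filter] at h1 ⊢
      rw [Fin.sum_univ_succ]
      simp only [Fin.cons_zero, Fin.cons_succ]
      omega

/-- Each left vertex has degree `m` and each right vertex has degree at most `m`, so the edges
split into `m` matchings, each covering all the left vertices. -/
theorem exists_edge_colouring_s2 {α β : Type*} [Fintype α] [Fintype β] [DecidableEq α]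
    [DecidableEq β] (m : ℕ) (E : α → β → Prop) [∀ a, DecidablePred (E a)]
    (hrow : ∀ a, (Finset.univ.filter fun b => E a b).card = m)
    (hcol : ∀ b, (Finset.univ.filter fun a => E a b).card ≤ m) :
    ∃ G : α → Fin m → β, (∀ a c, E a (G a c)) ∧ (∀ a, Function.Injective (G a)) ∧
      ∀ c, Function.Injective fun a => G a c := by
  let M : α ⊕ β → β ⊕ α → ℕ := fun u v =>
    match u, v with
    | .inl a, .inl b => if E a b then 1 else 0
    | .inl _, .inr _ => 0
    | .inr b, .inl b' => if b = b' then m - (Finset.univ.filter fun a => E a b).card else 0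
    | .inr b, .inr a => if E a b then 1 else 0
  obtain ⟨σ, hσ, hcount⟩ := exists_decomposition_of_regular m M
    (by
      rintro (a | b)
      · simp [M, ← hrow a, Fintype.sum_sum_type]
      · have := hcol b
        simp only [Fintype.sum_sum_type, M, Finset.sum_ite_eq, Finset.mem_univ, if_true,
          ← Finset.card_filter]
        omega)
    (by
      rintro (b | a)
      · have := hcol b
        simp only [Fintype.sum_sum_type, M, Finset.sum_ite_eq', Finset.mem_univ, if_true,
          ← Finset.card_filter]
        omega
      · simp [M, ← hrow a, Fintype.sum_sum_type])
  have hex : ∀ a c, ∃ b, σ c (.inl a) = .inl b := by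
    intro a c
    rcases hs : σ c (.inl a) with b | a'
    · exact ⟨b, rfl⟩
    · have h0 : (Finset.univ.filter fun c => σ c (.inl a) = .inr a').card = 0 := hcount _ _
      rw [Finset.card_eq_zero, Finset.filter_eq_empty_iff] at h0
      exact absurd hs (h0 (Finset.mem_univ c))
  choose G hG using hex
  have hGE : ∀ a b, (Finset.univ.filter fun c => σ c (.inl a) = .inl b).card =
      if E a b then 1 else 0 := fun a b => hcount _ _
  refine ⟨G, fun a c => ?_, fun a c c' h => ?_, fun c a a' h => ?_⟩
  · by_contra hE
    have h0 := hGE a (G a c)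
    rw [if_neg hE, Finset.card_eq_zero, Finset.filter_eq_empty_iff] at h0
    exact h0 (Finset.mem_univ c) (hG a c)
  · have h1 : (Finset.univ.filter fun c => σ c (.inl a) = .inl (G a c')).card ≤ 1 := by
      rw [hGE]
      split_ifs <;> omega
    refine Finset.card_le_one.1 h1 c ?_ c' ?_ <;>
      simp only [Finset.mem_filter, Finset.mem_univ, true_and, hG, h]
  · have h1 : σ c (.inl a) = σ c (.inl a') := by
      rw [hG, hG]
      exact congrArg _ h
    exact Sum.inl_injective (hσ c h1)

theorem IsProperArray.occ_le_card_rows {X Y Z : Type*} [Fintype X] [Fintype Y] [DecidableEq Z]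
    {F : X → Y → Z} (hF : IsProperArray F) (z : Z) :
    occ F z ≤ (Finset.univ.filter fun x => ¬ ∀ y, F x y ≠ z).card := by
  refine Finset.card_le_card_of_injOn Prod.fst ?_ ?_
  · rintro ⟨x, y⟩ hp
    have hp' := (Finset.mem_filter.1 hp).2
    exact Finset.mem_coe.2 (Finset.mem_filter.2 ⟨Finset.mem_univ _, fun h => h y hp'⟩)
  · rintro ⟨x, y⟩ hp ⟨x', y'⟩ hp' h
    obtain rfl : x = x' := h
    exact Prod.ext rfl (hF.1 x ((Finset.mem_filter.1 hp).2.trans (Finset.mem_filter.1 hp').2.symm))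

theorem IsProperArray.exists_extend_columns {X Y Z : Type*} [Fintype X] [Fintype Y] [Fintype Z]
    [DecidableEq X] [DecidableEq Z] {F : X → Y → Z} (hF : IsProperArray F) (m : ℕ)
    (hZ : Fintype.card Z = Fintype.card Y + m) (hocc : ∀ z, Fintype.card X ≤ occ F z + m) :
    ∃ F' : X → Y ⊕ Fin m → Z, IsProperArray F' ∧ ∀ x y, F' x (.inl y) = F x y := by
  obtain ⟨G, hGE, hGr, hGc⟩ := exists_edge_colouring_s2 m (fun x z => ∀ y, F x y ≠ z)
    (by
      intro x
      have h1 : (Finset.univ.filter fun z => ∀ y, F x y ≠ z) = (Finset.univ.image (F x))ᶜ := by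
        ext z
        simp
      rw [h1, Finset.card_compl, Finset.card_image_of_injective _ (hF.1 x), Finset.card_univ]
      omega)
    (by
      intro z
      have h1 := hF.occ_le_card_rows z
      have h2 := Finset.card_filter_add_card_filter_not (s := Finset.univ)
        (fun x => ∀ y, F x y ≠ z)
      have h3 := hocc z
      rw [Finset.card_univ] at h2
      omega)
  refine ⟨fun x => Sum.elim (F x) (G x), ⟨fun x => ?_, ?_⟩, fun _ _ => rfl⟩
  · exact Function.Injective.sumElim (hF.1 x) (hGr x) (fun y c => hGE x c y)
  · rintro (y | c)
    · exact hF.2 y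
    · exact hGc c

theorem IsProperArray.swap {X Y Z : Type*} {F : X → Y → Z} (hF : IsProperArray F) :
    IsProperArray fun y x => F x y :=
  ⟨hF.2, hF.1⟩

theorem IsProperArray.occ_of_card_eq {X Y Z : Type*} [Fintype X] [Fintype Y] [Fintype Z]
    [DecidableEq Z] {F : X → Y → Z} (hF : IsProperArray F)
    (hZ : Fintype.card Z = Fintype.card Y) (z : Z) : occ F z = Fintype.card X := by
  have hsurj : ∀ x, ∃ y, F x y = z := fun x =>
    ((Fintype.bijective_iff_injective_and_card (F x)).2 ⟨hF.1 x, hZ.symm⟩).2 z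
  choose g hg using hsurj
  rw [occ, ← Finset.card_univ]
  symm
  refine Finset.card_bij (fun x _ => (x, g x)) (fun x _ => ?_) (fun x _ x' _ h => ?_) ?_
  · simp [hg]
  · exact (Prod.ext_iff.1 h).1
  · rintro ⟨x, y⟩ hp
    refine ⟨x, Finset.mem_univ _, ?_⟩
    have hp' := (Finset.mem_filter.1 hp).2
    rw [hF.1 x ((hg x).trans hp'.symm)]

theorem occ_swap {X Y Z : Type*} [Fintype X] [Fintype Y] [DecidableEq Z] (F : X → Y → Z) (z : Z) :
    occ (fun y x => F x y) z = occ F z := by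
  refine Finset.card_bij (fun p _ => p.swap) ?_ ?_ ?_
  · intro p hp
    simpa using hp
  · intro p _ p' _ h
    exact Prod.swap_injective h
  · intro p hp
    exact ⟨p.swap, by simpa using hp, by simp⟩

/-- The embedding theorem of Ryser. -/
theorem IsProperArray.exists_latin_extension {X Z : Type*} [Fintype X] [Fintype Z]
    [DecidableEq X] [DecidableEq Z] {F : X → X → Z} (hF : IsProperArray F) (m : ℕ)
    (hZ : Fintype.card Z = Fintype.card X + m) (hocc : ∀ z, Fintype.card X ≤ occ F z + m) :
    ∃ L : X ⊕ Fin m → X ⊕ Fin m → Z, IsProperArray L ∧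
      ∀ x y, L (.inl x) (.inl y) = F x y := by
  obtain ⟨F', hF', hext⟩ := hF.exists_extend_columns m hZ hocc
  have hcard : Fintype.card Z = Fintype.card (X ⊕ Fin m) := by simp [hZ]
  obtain ⟨L, hL, hext'⟩ := hF'.swap.exists_extend_columns m hZ (fun z => by
    rw [occ_swap, hF'.occ_of_card_eq hcard]
    simp)
  exact ⟨fun x y => L y x, hL.swap, fun x y => (hext' _ _).trans (hext x y)⟩

theorem occ_sum_columns {X Y Y' Z : Type*} [Fintype X] [Fintype Y] [Fintype Y'] [DecidableEq Z]
    (F : X → Y ⊕ Y' → Z) (z : Z) :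
    occ F z = occ (fun x y => F x (.inl y)) z + occ (fun x y => F x (.inr y)) z := by
  simp only [occ, Finset.card_filter, Fintype.sum_prod_type, Fintype.sum_sum_type,
    Finset.sum_add_distrib]

theorem occ_sum_rows {X X' Y Z : Type*} [Fintype X] [Fintype X'] [Fintype Y] [DecidableEq Z]
    (F : X ⊕ X' → Y → Z) (z : Z) :
    occ F z = occ (fun x y => F (.inl x) y) z + occ (fun x y => F (.inr x) y) z := by
  simp only [occ, Finset.card_filter, Fintype.sum_prod_type, Fintype.sum_sum_type]

theorem IsProperArray.map {X Y Z X' Y' Z' : Type*} {F : X → Y → Z} (hF : IsProperArray F)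
    {f : X' → X} {g : Y' → Y} {h : Z → Z'} (hf : Function.Injective f)
    (hg : Function.Injective g) (hh : Function.Injective h) :
    IsProperArray fun x y => h (F (f x) (g y)) :=
  ⟨fun x => hh.comp ((hF.1 (f x)).comp hg), fun y => hh.comp ((hF.2 (g y)).comp hf)⟩

theorem IsProperArray.block {X Y Z X' Y' : Type*} {F : X → Y → Z} (hF : IsProperArray F)
    {f : X' → X} {g : Y' → Y} (hf : Function.Injective f) (hg : Function.Injective g) :
    IsProperArray fun x y => F (f x) (g y) :=
  hF.map hf hg Function.injective_id

theorem IsProperArray.occ_le_card {X Y Z : Type*} [Fintype X] [Fintype Y] [DecidableEq Z]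
    {F : X → Y → Z} (hF : IsProperArray F) (z : Z) : occ F z ≤ Fintype.card X :=
  (hF.occ_le_card_rows z).trans (Finset.card_le_univ _)

theorem occ_comp {X Y Z Z' : Type*} [Fintype X] [Fintype Y] [DecidableEq Z] [DecidableEq Z']
    (F : X → Y → Z) {g : Z → Z'} {z : Z} {z' : Z'} (h : ∀ u, g u = z' ↔ u = z) :
    occ (fun x y => g (F x y)) z' = occ F z := by
  simp only [occ, h]

section Step

variable {P B Q : Type*}

/-- Symbols of the old square, kept unchanged. -/
def keepSymbol : P ⊕ (B ⊕ Q) → (P ⊕ B) ⊕ (B ⊕ Q)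
  | .inl p => .inl (.inl p)
  | .inr (.inl b) => .inl (.inr b)
  | .inr (.inr q) => .inr (.inr q)

/-- Symbols of the old square, those from `B` being replaced by their new copies. -/
def renameSymbol : P ⊕ (B ⊕ Q) → (P ⊕ B) ⊕ (B ⊕ Q)
  | .inl p => .inl (.inl p)
  | .inr (.inl b) => .inr (.inl b)
  | .inr (.inr q) => .inr (.inr q)

theorem keepSymbol_injective : Function.Injective (keepSymbol (P := P) (B := B) (Q := Q)) := by
  rintro (p | b | q) (p' | b' | q') h <;> simp_all [keepSymbol]

theorem renameSymbol_injective :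
    Function.Injective (renameSymbol (P := P) (B := B) (Q := Q)) := by
  rintro (p | b | q) (p' | b' | q') h <;> simp_all [renameSymbol]

theorem eq_of_keepSymbol_eq_renameSymbol {u v : P ⊕ (B ⊕ Q)}
    (h : keepSymbol u = renameSymbol v) : u = v := by
  rcases u with p | b | q <;> rcases v with p' | b' | q' <;>
    simp_all [renameSymbol, keepSymbol]

theorem renameSymbol_ne {u : P ⊕ (B ⊕ Q)} {b : B} : renameSymbol u ≠ .inl (.inr b) := by
  rcases u with p | b | q <;> simp [renameSymbol]

/-- The corner of the old square on `P`, bordered by `B`, with the latin square `K` in the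
`B × B` block. -/
def borderedArray (L : P ⊕ (B ⊕ Q) → P ⊕ (B ⊕ Q) → P ⊕ (B ⊕ Q)) (K : B → B → B) :
    P ⊕ B → P ⊕ B → (P ⊕ B) ⊕ (B ⊕ Q)
  | .inl x, .inl y => keepSymbol (L (.inl x) (.inl y))
  | .inl x, .inr y => renameSymbol (L (.inl x) (.inr (.inl y)))
  | .inr x, .inl y => renameSymbol (L (.inr (.inl x)) (.inl y))
  | .inr x, .inr y => .inl (.inr (K x y))

variable {L : P ⊕ (B ⊕ Q) → P ⊕ (B ⊕ Q) → P ⊕ (B ⊕ Q)} {K : B → B → B}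

theorem borderedArray_isProperArray (hL : IsProperArray L) (hK : IsProperArray K) :
    IsProperArray (borderedArray L K) := by
  constructor
  · rintro (x | x) (y | y) (y' | y') h
    · exact congrArg _ (Sum.inl_injective (hL.1 _ (keepSymbol_injective h)))
    · exact absurd (hL.1 _ (eq_of_keepSymbol_eq_renameSymbol h)) (by simp)
    · exact absurd (hL.1 _ (eq_of_keepSymbol_eq_renameSymbol h.symm)) (by simp)
    · exact congrArg _ (Sum.inl_injective (Sum.inr_injective (hL.1 _ (renameSymbol_injective h))))
    · exact congrArg _ (Sum.inl_injective (hL.1 _ (renameSymbol_injective h)))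
    · exact absurd h renameSymbol_ne
    · exact absurd h.symm renameSymbol_ne
    · exact congrArg _ (hK.1 _ (Sum.inr_injective (Sum.inl_injective h)))
  · rintro (y | y) (x | x) (x' | x') h
    · exact congrArg _ (Sum.inl_injective (hL.2 _ (keepSymbol_injective h)))
    · exact absurd (hL.2 _ (eq_of_keepSymbol_eq_renameSymbol h)) (by simp)
    · exact absurd (hL.2 _ (eq_of_keepSymbol_eq_renameSymbol h.symm)) (by simp)
    · exact congrArg _ (Sum.inl_injective (Sum.inr_injective (hL.2 _ (renameSymbol_injective h))))
    · exact congrArg _ (Sum.inl_injective (hL.2 _ (renameSymbol_injective h)))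
    · exact absurd h renameSymbol_ne
    · exact absurd h.symm renameSymbol_ne
    · exact congrArg _ (hK.2 _ (Sum.inr_injective (Sum.inl_injective h)))

variable [Fintype P] [Fintype B] [DecidableEq P] [DecidableEq B] [DecidableEq Q]

theorem occ_borderedArray (z : (P ⊕ B) ⊕ (B ⊕ Q)) :
    occ (borderedArray L K) z =
      occ (fun x y => keepSymbol (L (.inl x) (.inl y))) z +
      occ (fun x y => renameSymbol (L (.inl x) (.inr (.inl y)))) z +
      (occ (fun x y => renameSymbol (L (.inr (.inl x)) (.inl y))) z +
      occ (fun x y => (.inl (.inr (K x y)) : (P ⊕ B) ⊕ (B ⊕ Q))) z) := by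
  rw [occ_sum_rows, occ_sum_columns, occ_sum_columns (X := B)]
  rfl

variable [Fintype Q]

theorem occ_borderedArray_old (hL : IsProperArray L) {z : (P ⊕ B) ⊕ (B ⊕ Q)} {u : P ⊕ (B ⊕ Q)}
    (hkeep : ∀ v, keepSymbol v = z ↔ v = u) (hrename : ∀ v, renameSymbol v = z ↔ v = u)
    (hz : ∀ b, z ≠ .inl (.inr b)) :
    occ (borderedArray L K) z + occ (fun x y => L (.inr (.inl x)) (.inr (.inl y))) u +
      Fintype.card Q = Fintype.card P + Fintype.card B +
        occ (fun x y => L (.inr (.inr x)) (.inr (.inr y))) u := by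
  rw [occ_borderedArray, occ_comp _ hkeep, occ_comp _ hrename, occ_comp _ hrename]
  have h0 : occ (fun x y => (.inl (.inr (K x y)) : (P ⊕ B) ⊕ (B ⊕ Q))) z = 0 := by
    rw [occ, Finset.card_eq_zero, Finset.filter_eq_empty_iff]
    exact fun p _ h => hz _ h.symm
  have hP := (hL.block (f := Sum.inl) (g := id) Sum.inl_injective
    Function.injective_id).occ_of_card_eq rfl u
  have hB := (hL.block (f := Sum.inr ∘ Sum.inl) (g := id)
    (Sum.inr_injective.comp Sum.inl_injective) Function.injective_id).occ_of_card_eq rfl u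
  have hQ := (hL.swap.block (f := Sum.inr ∘ Sum.inr) (g := id)
    (Sum.inr_injective.comp Sum.inr_injective) Function.injective_id).occ_of_card_eq rfl u
  rw [occ_sum_columns, occ_sum_columns (Y := B)] at hP hB
  rw [occ_swap, occ_sum_rows, occ_sum_rows (X := B)] at hQ
  simp only [Function.comp_apply, id_eq] at hP hB hQ
  omega

theorem le_occ_borderedArray_new (hL : IsProperArray L) (hK : IsProperArray K) (b : B) :
    Fintype.card P ≤ occ (borderedArray L K) (.inl (.inr b)) + Fintype.card Q := by
  rw [occ_borderedArray]
  have h1 : occ (fun x y => keepSymbol (L (.inl x) (.inl y))) (.inl (.inr b)) =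
      occ (fun x y => L (.inl x) (.inl y)) (.inr (.inl b)) := by
    apply occ_comp
    rintro (p | b | q) <;> simp [keepSymbol]
  have h2 : occ (fun x y => (.inl (.inr (K x y)) : (P ⊕ B) ⊕ (B ⊕ Q))) (.inl (.inr b)) =
      occ K b := by
    apply occ_comp (g := fun b : B => (.inl (.inr b) : (P ⊕ B) ⊕ (B ⊕ Q)))
    simp
  have h3 := hK.occ_of_card_eq rfl b
  have hP := (hL.block (f := Sum.inl) (g := id) Sum.inl_injective
    Function.injective_id).occ_of_card_eq rfl (.inr (.inl b))
  have h4 := (hL.block (f := Sum.inl) (g := Sum.inr) Sum.inl_injective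
    Sum.inr_injective).swap.occ_le_card (.inr (.inl b))
  rw [occ_swap, Fintype.card_sum] at h4
  rw [occ_sum_columns] at hP
  simp only [id_eq] at hP
  omega

/-- The bordered array can be balanced, with all cells of equal class frozen. -/
theorem exists_balanced_bordered {cl : P ⊕ B → ℕ} {H : ℕ} (hL : IsProperArray L)
    (hK : IsProperArray K) (hBB : ∀ b b', cl (.inr b) = cl (.inr b'))
    (hPB : ∀ x b, cl (.inl x) ≠ cl (.inr b))
    (hcl : ∀ x y, cl (.inl x) = cl (.inl y) →
      ∃ z, cl (.inl z) = cl (.inl x) ∧ L (.inl x) (.inl y) = .inl z)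
    (hH : ∀ i, (Finset.univ.filter fun x => cl x = i).card ≤ H) (hQH : H ≤ Fintype.card Q)
    (hbal : ∑ q, occ (fun x y => L (.inr (.inl x)) (.inr (.inl y))) (.inr (.inr q)) ≤
      ∑ q, occ (fun x y => L (.inr (.inr x)) (.inr (.inr y))) (.inr (.inr q))) :
    ∃ A : P ⊕ B → P ⊕ B → (P ⊕ B) ⊕ (B ⊕ Q), IsProperArray A ∧
      (∀ x y, cl x = cl y → ∃ z, cl z = cl x ∧ A x y = .inl z) ∧
      ∀ z, Fintype.card (P ⊕ B) ≤ occ A z + Fintype.card (B ⊕ Q) := by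
  have hA := borderedArray_isProperArray hL hK
  have hfroz : ∀ x y, cl x = cl y → ∃ z, cl z = cl x ∧ borderedArray L K x y = .inl z := by
    rintro (x | x) (y | y) h
    · obtain ⟨z, hz, hLz⟩ := hcl x y h
      exact ⟨.inl z, hz, by rw [borderedArray, hLz]; rfl⟩
    · exact absurd h (hPB _ _)
    · exact absurd h.symm (hPB _ _)
    · exact ⟨.inr (K x y), hBB _ _, rfl⟩
  have hP : ∀ p, occ (borderedArray L K) (.inl (.inl p)) +
      occ (fun x y => L (.inr (.inl x)) (.inr (.inl y))) (.inl p) + Fintype.card Q =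
      Fintype.card P + Fintype.card B +
        occ (fun x y => L (.inr (.inr x)) (.inr (.inr y))) (.inl p) := by
    intro p
    apply occ_borderedArray_old hL
    · rintro (p | b | q) <;> simp [keepSymbol]
    · rintro (p | b | q) <;> simp [renameSymbol]
    · simp
  have hQ : ∀ q, occ (borderedArray L K) (.inr (.inr q)) +
      occ (fun x y => L (.inr (.inl x)) (.inr (.inl y))) (.inr (.inr q)) + Fintype.card Q =
      Fintype.card P + Fintype.card B +
        occ (fun x y => L (.inr (.inr x)) (.inr (.inr y))) (.inr (.inr q)) := by
    intro q
    apply occ_borderedArray_old hL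
    · rintro (p | b | q) <;> simp [keepSymbol]
    · rintro (p | b | q) <;> simp [renameSymbol]
    · simp
  have hbb : ∀ u, occ (fun x y => L (.inr (.inl x)) (.inr (.inl y))) u ≤ Fintype.card B :=
    fun u => (hL.block (f := Sum.inr ∘ Sum.inl) (g := Sum.inr ∘ Sum.inl)
      (Sum.inr_injective.comp Sum.inl_injective)
      (Sum.inr_injective.comp Sum.inl_injective)).occ_le_card u
  rcases le_total (Fintype.card (P ⊕ B)) (Fintype.card (B ⊕ Q)) with hle | hle
  · exact ⟨_, hA, hfroz, fun z => hle.trans (Nat.le_add_left _ _)⟩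
  obtain ⟨T, hT⟩ := Nat.exists_eq_add_of_le hle
  have hT' := hT
  rw [Fintype.card_sum, Fintype.card_sum] at hT'
  have hmemD : ∀ p : (P ⊕ B) × (P ⊕ B),
      p ∈ (Finset.univ.filter fun p : (P ⊕ B) × (P ⊕ B) => cl p.1 = cl p.2) ↔ cl p.1 = cl p.2 := by
    simp
  have hfrozD : ∀ p ∈ (Finset.univ.filter fun p : (P ⊕ B) × (P ⊕ B) => cl p.1 = cl p.2),
      ∀ w, borderedArray L K p.1 p.2 ≠ .inr w := by
    intro p hp w hw
    obtain ⟨z, -, hz⟩ := hfroz p.1 p.2 ((hmemD p).1 hp)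
    rw [hz] at hw
    cases hw
  obtain ⟨A, hA', hfix, hocc⟩ := hA.exists_balanced
    (Finset.univ.filter fun p : (P ⊕ B) × (P ⊕ B) => cl p.1 = cl p.2)
    (Finset.univ.image fun q : Q => (.inr (.inr q) : (P ⊕ B) ⊕ (B ⊕ Q)))
    (Finset.univ.image fun b : B => (.inr (.inl b) : (P ⊕ B) ⊕ (B ⊕ Q))) T H
    (by
      rw [Finset.disjoint_left]
      simp)
    (by
      intro p hp h
      obtain ⟨q, -, hq⟩ := Finset.mem_image.1 h
      exact hfrozD p hp _ hq.symm)
    (by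
      intro p hp h
      obtain ⟨b, -, hb⟩ := Finset.mem_image.1 h
      exact hfrozD p hp _ hb.symm)
    (by
      rintro ((p | b) | (b | q)) hz
      · have h1 := hP p
        have h2 := hbb (.inl p)
        omega
      · have := le_occ_borderedArray_new hL hK b
        omega
      · simp at hz
      · have h1 := hQ q
        have h2 := hbb (.inr (.inr q))
        omega)
    (by
      intro z
      rcases Finset.eq_empty_or_nonempty ((Finset.univ.filter
        fun p : (P ⊕ B) × (P ⊕ B) => cl p.1 = cl p.2).filter
        fun p => borderedArray L K p.1 p.2 = z) with h | ⟨p0, hp0⟩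
      · rw [h]
        exact Nat.zero_le _
      · refine le_trans ?_ (hH (cl p0.1))
        have hclass : ∀ x y, cl x = cl y → borderedArray L K x y = z → cl x = cl p0.1 := by
          intro x y hxy h
          rw [Finset.mem_filter, hmemD] at hp0
          obtain ⟨z0, hz0, h0⟩ := hfroz _ _ hp0.1
          obtain ⟨z1, hz1, h1⟩ := hfroz _ _ hxy
          have : z0 = z1 := Sum.inl_injective (h0.symm.trans (hp0.2.trans (h.symm.trans h1)))
          rw [← hz0, ← hz1, this]
        refine Finset.card_le_card_of_injOn Prod.fst ?_ ?_
        · intro p hp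
          rw [Finset.mem_coe, Finset.mem_filter, hmemD] at hp
          exact Finset.mem_coe.2 (Finset.mem_filter.2
            ⟨Finset.mem_univ _, hclass _ _ hp.1 hp.2⟩)
        · rintro ⟨x, y⟩ hp ⟨x', y'⟩ hp' h
          rw [Finset.mem_coe, Finset.mem_filter] at hp hp'
          obtain rfl : x = x' := h
          exact Prod.ext rfl (hA.1 x (hp.2.trans hp'.2.symm)))
    (by
      rw [Fintype.card_sum (α := P ⊕ B), hT]
      nlinarith)
    (by
      right
      rw [Finset.sum_image (fun _ _ _ _ h => Sum.inr_injective (Sum.inr_injective h)),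
        Finset.card_image_of_injective _ fun _ _ h => Sum.inl_injective (Sum.inr_injective h),
        Finset.card_univ]
      have h1 : ∑ q, (occ (borderedArray L K) (.inr (.inr q)) - T) +
          ∑ q, occ (fun x y => L (.inr (.inl x)) (.inr (.inl y))) (.inr (.inr q)) =
          Fintype.card Q * Fintype.card B +
            ∑ q, occ (fun x y => L (.inr (.inr x)) (.inr (.inr y))) (.inr (.inr q)) := by
        rw [← Finset.card_univ (α := Q), ← smul_eq_mul, ← Finset.sum_const,
          ← Finset.sum_add_distrib, ← Finset.sum_add_distrib]
        refine Finset.sum_congr rfl fun q _ => ?_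
        have h1 := hQ q
        have h2 := hbb (.inr (.inr q))
        omega
      have h2 : Fintype.card B * H ≤ Fintype.card Q * Fintype.card B := by
        rw [mul_comm]
        exact Nat.mul_le_mul_right _ hQH
      omega)
  refine ⟨A, hA', fun x y h => ?_, fun z => ?_⟩
  · rw [hfix (x, y) ((hmemD _).2 h)]
    exact hfroz x y h
  · have := hocc z
    omega

end Step

theorem exists_isProperArray_fin (m : ℕ) : ∃ K : Fin m → Fin m → Fin m, IsProperArray K := by
  cases m with
  | zero => exact ⟨fun i => i.elim0, fun i => i.elim0, fun i => i.elim0⟩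
  | succ m =>
    exact ⟨fun i j => i + j, fun i => add_right_injective i, fun j => add_left_injective j⟩

/-- Exchanges the two copies of `B`. -/
def exchangeCopies {P B Q : Type*} : P ⊕ (B ⊕ (B ⊕ Q)) → P ⊕ (B ⊕ (B ⊕ Q))
  | .inl p => .inl p
  | .inr (.inl b) => .inr (.inr (.inl b))
  | .inr (.inr (.inl b)) => .inr (.inl b)
  | .inr (.inr (.inr q)) => .inr (.inr (.inr q))

theorem exchangeCopies_injective {P B Q : Type*} :
    Function.Injective (exchangeCopies (P := P) (B := B) (Q := Q)) := by
  rintro (p | b | b | q) (p' | b' | b' | q') h <;> simp_all [exchangeCopies]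

/-- Exchanging the two copies of `B` among rows and columns if necessary, the symbols of `B ⊕ Q`
occur at most as often in the `B × B` block as in the complementary `(B ⊕ Q) × (B ⊕ Q)` block. -/
theorem exists_exchange_le {P B Q : Type*} [Fintype B] [Fintype Q] [DecidableEq P]
    [DecidableEq B] [DecidableEq Q]
    {L : P ⊕ (B ⊕ (B ⊕ Q)) → P ⊕ (B ⊕ (B ⊕ Q)) → P ⊕ (B ⊕ (B ⊕ Q))} (hL : IsProperArray L) :
    ∃ L' : P ⊕ (B ⊕ (B ⊕ Q)) → P ⊕ (B ⊕ (B ⊕ Q)) → P ⊕ (B ⊕ (B ⊕ Q)), IsProperArray L' ∧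
      (∀ x y, L' (.inl x) (.inl y) = L (.inl x) (.inl y)) ∧
      ∑ q, occ (fun x y => L' (.inr (.inl x)) (.inr (.inl y))) (.inr (.inr q)) ≤
        ∑ q, occ (fun x y => L' (.inr (.inr x)) (.inr (.inr y))) (.inr (.inr q)) := by
  have hcopy : ∀ F : P ⊕ (B ⊕ (B ⊕ Q)) → P ⊕ (B ⊕ (B ⊕ Q)) → P ⊕ (B ⊕ (B ⊕ Q)),
      ∑ q, occ (fun x y => F (.inr (.inr (.inl x))) (.inr (.inr (.inl y)))) (.inr (.inr q)) ≤
        ∑ q, occ (fun x y => F (.inr (.inr x)) (.inr (.inr y))) (.inr (.inr q)) := by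
    intro F
    refine Finset.sum_le_sum fun q _ => ?_
    rw [occ_sum_rows, occ_sum_columns]
    omega
  rcases le_total (∑ q, occ (fun x y => L (.inr (.inl x)) (.inr (.inl y))) (.inr (.inr q)))
    (∑ q, occ (fun x y => L (.inr (.inr x)) (.inr (.inr y))) (.inr (.inr q))) with h | h
  · exact ⟨L, hL, fun _ _ => rfl, h⟩
  · exact ⟨fun x y => L (exchangeCopies x) (exchangeCopies y),
      hL.block exchangeCopies_injective exchangeCopies_injective, fun _ _ => rfl,
      (hcopy L).trans (h.trans (hcopy fun x y => L (exchangeCopies x) (exchangeCopies y)))⟩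

theorem card_filter_sumElim {P : Type*} [Fintype P] (cl : P → ℕ) (b i j : ℕ) :
    (Finset.univ.filter fun x : P ⊕ Fin b => Sum.elim cl (fun _ => i) x = j).card =
      (Finset.univ.filter fun x => cl x = j).card + if i = j then b else 0 := by
  rw [Finset.card_filter, Fintype.sum_sum_type, Finset.card_filter]
  congr 1
  by_cases h : i = j <;> simp [h]

theorem exists_add_class {P : Type*} [Fintype P] [DecidableEq P] {m b H i : ℕ} {cl : P → ℕ}
    (hm : 2 * H ≤ m) (hb : b ≤ H) (hi : ∀ x, cl x ≠ i)
    (hH : ∀ j, (Finset.univ.filter fun x => cl x = j).card ≤ H)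
    {L : P ⊕ Fin m → P ⊕ Fin m → P ⊕ Fin m} (hL : IsProperArray L)
    (hcl : ∀ x y, cl x = cl y → ∃ z, cl z = cl x ∧ L (.inl x) (.inl y) = .inl z) :
    ∃ L' : (P ⊕ Fin b) ⊕ Fin m → (P ⊕ Fin b) ⊕ Fin m → (P ⊕ Fin b) ⊕ Fin m,
      IsProperArray L' ∧ ∀ x y, Sum.elim cl (fun _ => i) x = Sum.elim cl (fun _ => i) y →
        ∃ z, Sum.elim cl (fun _ => i) z = Sum.elim cl (fun _ => i) x ∧
          L' (.inl x) (.inl y) = .inl z := by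
  have hcard : Fintype.card (Fin b ⊕ (Fin b ⊕ Fin (m - 2 * b))) = m := by
    simp only [Fintype.card_sum, Fintype.card_fin]
    omega
  let e : Fin b ⊕ (Fin b ⊕ Fin (m - 2 * b)) ≃ Fin m := Fintype.equivFinOfCardEq hcard
  let e₁ : P ⊕ (Fin b ⊕ (Fin b ⊕ Fin (m - 2 * b))) ≃ P ⊕ Fin m := Equiv.sumCongr (Equiv.refl P) e
  obtain ⟨L₂, hL₂, hext, hbal⟩ := exists_exchange_le
    (hL.map e₁.injective e₁.injective e₁.symm.injective)
  obtain ⟨K, hK⟩ := exists_isProperArray_fin b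
  obtain ⟨A, hA, hAcl, hocc⟩ := exists_balanced_bordered (cl := Sum.elim cl fun _ => i) (H := H)
    hL₂ hK (fun _ _ => rfl) (fun x _ => hi x)
    (by
      intro x y hxy
      obtain ⟨z, hz, hLz⟩ := hcl x y hxy
      refine ⟨z, hz, ?_⟩
      rw [hext]
      change e₁.symm (L (.inl x) (.inl y)) = _
      rw [hLz]
      rfl)
    (by
      intro j
      rw [card_filter_sumElim]
      by_cases hj : i = j
      · subst hj
        have h0 : (Finset.univ.filter fun x => cl x = i) = ∅ :=
          Finset.filter_eq_empty_iff.2 fun x _ => hi x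
        simpa [h0] using hb
      · simpa [hj] using hH j)
    (by
      simp only [Fintype.card_sum, Fintype.card_fin]
      omega)
    hbal
  obtain ⟨L₃, hL₃, hext₃⟩ := hA.exists_latin_extension m
    (by rw [Fintype.card_sum (α := P ⊕ Fin b), hcard])
    (fun z => by simpa only [hcard] using hocc z)
  let e₂ := Equiv.sumCongr (Equiv.refl (P ⊕ Fin b)) e
  refine ⟨fun x y => e₂ (L₃ x y), hL₃.map Function.injective_id Function.injective_id
    e₂.injective, fun x y hxy => ?_⟩
  obtain ⟨z, hz, hAz⟩ := hAcl x y hxy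
  refine ⟨z, hz, ?_⟩
  change e₂ (L₃ (.inl x) (.inl y)) = _
  rw [hext₃, hAz]
  rfl

theorem exists_classes {m H : ℕ} (hm : 2 * H ≤ m) (g : ℕ → ℕ) (k : ℕ) (hg : ∀ i < k, g i ≤ H) :
    ∃ (P : Type) (_ : Fintype P) (_ : DecidableEq P) (cl : P → ℕ)
      (L : P ⊕ Fin m → P ⊕ Fin m → P ⊕ Fin m), IsProperArray L ∧ (∀ x, cl x < k) ∧
      (∀ i < k, (Finset.univ.filter fun x => cl x = i).card = g i) ∧
      ∀ x y, cl x = cl y → ∃ z, cl z = cl x ∧ L (.inl x) (.inl y) = .inl z := by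
  induction k with
  | zero =>
    obtain ⟨K, hK⟩ := exists_isProperArray_fin m
    let e := Equiv.emptySum Empty (Fin m)
    exact ⟨Empty, inferInstance, inferInstance, fun x => x.elim, _,
      hK.map e.injective e.injective e.symm.injective, fun x => x.elim,
      fun i hi => absurd hi (Nat.not_lt_zero i), fun x => x.elim⟩
  | succ k ih =>
    obtain ⟨P, _, _, cl, L, hL, hlt, hcard, hcl⟩ :=
      ih fun i hi => hg i (hi.trans (Nat.lt_succ_self k))
    obtain ⟨L', hL', hcl'⟩ := exists_add_class hm (hg k (Nat.lt_succ_self k))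
      (fun x => (hlt x).ne)
      (fun j => by
        by_cases hj : j < k
        · rw [hcard j hj]
          exact hg j (hj.trans (Nat.lt_succ_self k))
        · rw [Finset.card_eq_zero.2 (Finset.filter_eq_empty_iff.2
            fun x _ (h : cl x = j) => hj (h ▸ hlt x))]
          exact Nat.zero_le H) hL hcl
    refine ⟨P ⊕ Fin (g k), inferInstance, inferInstance, Sum.elim cl fun _ => k, L', hL', ?_, ?_,
      hcl'⟩
    · rintro (x | x)
      · exact (hlt x).trans (Nat.lt_succ_self k)
      · exact Nat.lt_succ_self k
    · intro i hi
      rw [card_filter_sumElim]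
      rcases Nat.lt_succ_iff_lt_or_eq.1 hi with h | rfl
      · simp [hcard i h, h.ne']
      · rw [Finset.card_eq_zero.2 (Finset.filter_eq_empty_iff.2 fun x _ => (hlt x).ne)]
        simp

/-- if `h_1 ≥ h_2 ≥ … ≥ h_k > 0` and
`n ≥ 2 h_1 + (h_1 + … + h_k)`, then an `ILS(n; h_1 … h_k)` exists. -/
theorem statement2 (k n : ℕ) (h : ℕ → ℕ) (hk : 1 ≤ k)
    (hpos : ∀ i, 1 ≤ i → i ≤ k → 0 < h i)
    (hmono : ∀ i, 1 ≤ i → i < k → h (i + 1) ≤ h i)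
    (hn : 2 * h 1 + ∑ i ∈ Finset.Icc 1 k, h i ≤ n) :
    HasILS n (fun i : Fin k => h ((i : ℕ) + 1)) := by
  have hle : ∀ i, i < k → h (i + 1) ≤ h 1 := by
    intro i
    induction i with
    | zero => exact fun _ => le_rfl
    | succ i ih => exact fun hi => (hmono (i + 1) (by omega) hi).trans (ih (by omega))
  obtain ⟨P, _, _, cl, L, hL, hlt, hcard, hcl⟩ := exists_classes
    (m := n - ∑ i ∈ Finset.Icc 1 k, h i) (H := h 1) (by omega) (fun i => h (i + 1)) k hle
  have hP : Fintype.card P = ∑ i ∈ Finset.Icc 1 k, h i := by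
    rw [← Finset.card_univ, Finset.card_eq_sum_card_fiberwise (f := cl) (t := Finset.range k)
      (fun x _ => Finset.mem_coe.2 (Finset.mem_range.2 (hlt x))),
      Finset.sum_congr rfl fun i hi => hcard i (Finset.mem_range.1 hi), Finset.range_eq_Ico,
      Finset.sum_Ico_add' h 0 k 1]
    rfl
  let e : P ⊕ Fin (n - ∑ i ∈ Finset.Icc 1 k, h i) ≃ Fin n := Fintype.equivFinOfCardEq (by
    rw [Fintype.card_sum, Fintype.card_fin, hP]
    omega)
  have hL' := hL.map e.symm.injective e.symm.injective e.injective
  have hinj : Function.Injective fun x : P => e (.inl x) := e.injective.comp Sum.inl_injective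
  let S : Fin k → Finset (Fin n) := fun i =>
    (Finset.univ.filter fun x => cl x = i).image fun x => e (.inl x)
  have hS : ∀ i, (S i).card = h ((i : ℕ) + 1) := fun i => by
    rw [Finset.card_image_of_injective _ hinj, hcard i i.2]
  have hdisj : ∀ i j, i ≠ j → Disjoint (S i) (S j) := by
    intro i j hij
    rw [Finset.disjoint_left]
    intro a hi hj
    obtain ⟨x, hx, rfl⟩ := Finset.mem_image.1 hi
    obtain ⟨y, hy, hxy⟩ := Finset.mem_image.1 hj
    obtain rfl := hinj hxy
    exact hij (Fin.ext ((Finset.mem_filter.1 hx).2.symm.trans (Finset.mem_filter.1 hy).2))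
  refine ⟨fun x y => e (L (e.symm x) (e.symm y)),
    ⟨fun i => Finite.injective_iff_bijective.1 (hL'.1 i),
      fun j => Finite.injective_iff_bijective.1 (hL'.2 j)⟩,
    S, S, S, hS, hS, hS, hdisj, hdisj, hdisj, fun i a ha a' ha' => ?_⟩
  obtain ⟨x, hxS, rfl⟩ := Finset.mem_image.1 ha
  obtain ⟨y, hyS, rfl⟩ := Finset.mem_image.1 ha'
  have hx := (Finset.mem_filter.1 hxS).2
  have hy := (Finset.mem_filter.1 hyS).2
  obtain ⟨z, hz, hLz⟩ := hcl x y (hx.trans hy.symm)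
  refine Finset.mem_image.2 ⟨z, Finset.mem_filter.2 ⟨Finset.mem_univ _, hz.trans hx⟩, ?_⟩
  simp only [Equiv.symm_apply_apply, hLz]
end
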